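/- arXiv:2406.15322 — 8 statements merged into one kernel-verified Lean document; each statement's English description precedes it below -/
import Mathlib

section
/- Let n be odd and L a 2-linear polynomial over F_{q^n}. Then Tr(x^{q+1}) + L(x) is a permutation polynomial of F_{q^n} if and only if L'(ker Tr) = ker Tr and the map x ↦ L'(x) + x^{1/2} induces an automorphism of the quotient additive group F_{q^n}/ker Tr (via ker Tr + α ↦ ker Tr + L'(α) + α^{1/2}). -/
/-- A preimage of a subgroup of a finite group under an endomorphism which is contained in that
subgroup is equal to it. -/
theorem AddSubgroup.comap_eq_of_comap_le {F : Type*} [AddCommGroup F] [Finite F] (L : F →+ F)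
    (W : AddSubgroup F) (h : W.comap L ≤ W) : W.comap L = W := by
  refine AddSubgroup.eq_of_le_of_card_ge h ?_
  have h1 := AddSubgroup.card_mul_index W
  have h2 := AddSubgroup.card_mul_index (W.comap L)
  rw [AddSubgroup.index_comap] at h2
  have h3 : W.relIndex L.range ≤ W.index :=
    Nat.le_of_dvd (Nat.pos_of_ne_zero AddSubgroup.index_ne_zero_of_finite)
      (AddSubgroup.relIndex_dvd_index_of_normal W L.range)
  have h4 : 0 < W.index := Nat.pos_of_ne_zero AddSubgroup.index_ne_zero_of_finite
  refine Nat.le_of_mul_le_mul_right ?_ h4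
  calc Nat.card W * W.index = Nat.card (W.comap L) * W.relIndex L.range := by rw [h1, h2]
    _ ≤ Nat.card (W.comap L) * W.index := Nat.mul_le_mul_left _ h3

/-- Duality between conditions on `L` and `N` relative to `W` and conditions on their adjoints
`L'` and `M` relative to the orthogonal complement `K` of `W`. -/
theorem adjoint_conditions_iff {F : Type*} [CommRing F] [Finite F] (T L N L' M : F →+ F)
    (W K : AddSubgroup F)
    (hLL : ∀ x y, T (x * L y) = T (L' x * y)) (hNM : ∀ x y, T (x * N y) = T (M x * y))
    (hnd : ∀ d, (∀ x, T (x * d) = 0) → d = 0)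
    (hKW : ∀ k ∈ K, ∀ w ∈ W, T (k * w) = 0)
    (hWK : ∀ x, (∀ w ∈ W, T (x * w) = 0) → x ∈ K)
    (hKW' : ∀ d, (∀ k ∈ K, T (k * d) = 0) → d ∈ W)
    (hN : ∀ w ∈ W, N w - L w ∈ W) (hM : ∀ k ∈ K, M k - L' k ∈ K) :
    ((∀ d, L d ∈ W → d ∈ W) ∧ ∀ w ∈ W, N w = 0 → w = 0) ↔
      (L' '' (K : Set F) = K ∧
        ∃ φ : F ⧸ K →+ F ⧸ K,
          (∀ x : F, φ (QuotientAddGroup.mk x) = QuotientAddGroup.mk (M x)) ∧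
          Function.Bijective φ) := by
  have hT0 : T 0 = 0 := map_zero T
  constructor
  · rintro ⟨h1, h2⟩
    have hWL : W.comap L = W := AddSubgroup.comap_eq_of_comap_le L W h1
    have hLW : ∀ w ∈ W, L w ∈ W := fun w hw ↦ by
      rw [← hWL] at hw; exact hw
    have hNW : ∀ w ∈ W, N w ∈ W := fun w hw ↦ by
      simpa using W.add_mem (hN w hw) (hLW w hw)
    have hL'K : ∀ k ∈ K, L' k ∈ K := fun k hk ↦
      hWK _ fun w hw ↦ by rw [← hLL]; exact hKW k hk _ (hLW w hw)
    have hMK : K ≤ K.comap M := fun k hk ↦ by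
      simpa using K.add_mem (hM k hk) (hL'K k hk)
    have hsum : ∀ y, ∃ x, y - L x ∈ W := by
      have hinj : Function.Injective (QuotientAddGroup.map W W L hWL.ge) := by
        rw [injective_iff_map_eq_zero]
        intro a
        induction a using QuotientAddGroup.induction_on with
        | H a =>
          intro ha
          rw [QuotientAddGroup.map_mk, QuotientAddGroup.eq_zero_iff] at ha
          exact (QuotientAddGroup.eq_zero_iff a).2 (h1 a ha)
      intro y
      obtain ⟨x, hx⟩ := Finite.surjective_of_injective hinj (QuotientAddGroup.mk y)
      induction x using QuotientAddGroup.induction_on with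
      | H x =>
        rw [QuotientAddGroup.map_mk, QuotientAddGroup.eq] at hx
        exact ⟨x, by rwa [neg_add_eq_sub] at hx⟩
    have hinjK : ∀ k ∈ K, L' k = 0 → k = 0 := fun k hk h0 ↦ hnd k fun y ↦ by
      obtain ⟨x, hx⟩ := hsum y
      have h3 : T (k * (y - L x)) = 0 := hKW k hk _ hx
      rw [mul_sub, map_sub, hLL, h0, zero_mul, hT0, sub_zero] at h3
      rwa [mul_comm]
    refine ⟨?_, QuotientAddGroup.map K K M hMK, fun x ↦ rfl, ?_⟩
    · refine Set.eq_of_subset_of_ncard_le ?_ ?_ (Set.toFinite _)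
      · rintro _ ⟨k, hk, rfl⟩
        exact hL'K k hk
      · refine (Set.InjOn.ncard_image ?_).ge
        intro x hx y hy hxy
        exact sub_eq_zero.1 (hinjK _ (K.sub_mem hx hy) (by rw [map_sub, sub_eq_zero]; exact hxy))
    · refine Finite.injective_iff_bijective.1 ((injective_iff_map_eq_zero _).2 ?_)
      have hNsurj : ∀ w ∈ W, ∃ v ∈ W, N v = w := by
        have : Function.Surjective (fun w : W ↦ (⟨N w, hNW w w.2⟩ : W)) := by
          refine Finite.surjective_of_injective fun x y hxy ↦ ?_
          have hxy' : N x = N y := congrArg Subtype.val hxy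
          refine Subtype.ext (sub_eq_zero.1 (h2 _ (W.sub_mem x.2 y.2) ?_))
          rw [map_sub, hxy', sub_self]
        intro w hw
        obtain ⟨v, hv⟩ := this ⟨w, hw⟩
        exact ⟨v, v.2, congrArg Subtype.val hv⟩
      intro a
      induction a using QuotientAddGroup.induction_on with
      | H a =>
        intro ha
        rw [QuotientAddGroup.map_mk, QuotientAddGroup.eq_zero_iff] at ha
        refine (QuotientAddGroup.eq_zero_iff a).2 (hWK _ fun w hw ↦ ?_)
        obtain ⟨v, hv, rfl⟩ := hNsurj w hw
        rw [hNM]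
        exact hKW _ ha v hv
  · rintro ⟨h1, φ, hφ, hbij⟩
    constructor
    · intro d hd
      refine hKW' d fun k hk ↦ ?_
      have hk' : k ∈ L' '' (K : Set F) := by rw [h1]; exact hk
      obtain ⟨l, hl, rfl⟩ := hk'
      rw [← hLL]
      exact hKW l hl _ hd
    · intro w hw h0
      refine hnd w fun x ↦ ?_
      obtain ⟨y, hy⟩ := hbij.2 (QuotientAddGroup.mk x)
      induction y using QuotientAddGroup.induction_on with
      | H y =>
        rw [hφ, QuotientAddGroup.eq] at hy
        have h3 := hKW _ hy w hw
        rw [add_mul, neg_mul, map_add, map_neg, ← hNM, h0, mul_zero, hT0, neg_zero, zero_add] at h3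
        exact h3

/-- A sum of iterated `Q`-th powers is not identically zero on a field with more than
`Q ^ (k - 1)` elements. -/
theorem exists_sum_pow_pow_ne_zero {F : Type*} [Field F] [Fintype F] {Q k : ℕ} (hQ : 1 < Q)
    (hk : 0 < k) (hcard : Q ^ k ≤ Fintype.card F) :
    ∃ z : F, ∑ i ∈ Finset.range k, z ^ Q ^ i ≠ 0 := by
  by_contra! h
  have hp := Polynomial.eq_zero_of_natDegree_lt_card_of_eval_eq_zero
    (∑ i ∈ Finset.range k, (Polynomial.X : Polynomial F) ^ Q ^ i) Function.injective_id
    (fun z ↦ by simpa [Polynomial.eval_finsetSum] using h z) (by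
      refine lt_of_le_of_lt (Polynomial.natDegree_sum_le_of_forall_le _ (n := Q ^ (k - 1)) _ ?_)
        (lt_of_lt_of_le (Nat.pow_lt_pow_right hQ (by omega)) hcard)
      intro i hi
      rw [Polynomial.natDegree_X_pow]
      exact Nat.pow_le_pow_right (by omega) (by have := Finset.mem_range.1 hi; omega))
  have hc := congrArg (fun p ↦ Polynomial.coeff p 1) hp
  simp only [Polynomial.finsetSum_coeff, Polynomial.coeff_X_pow, Polynomial.coeff_zero] at hc
  rw [Finset.sum_eq_single 0] at hc
  · simp at hc
  · intro i _ hi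
    rw [if_neg]
    exact (Nat.one_lt_pow hi hQ).ne
  · intro h0
    exact absurd (Finset.mem_range.2 hk) h0

/-- The sum of the iterated `Q`-th powers of an element fixed by the `k`-th iterate is invariant
under `Q`-th power. -/
theorem sum_pow_pow_pow_eq {F : Type*} [CommRing F] {Q k : ℕ} {z : F} (hz : z ^ Q ^ k = z) :
    ∑ i ∈ Finset.range k, (z ^ Q) ^ Q ^ i = ∑ i ∈ Finset.range k, z ^ Q ^ i := by
  have h1 := Finset.sum_range_succ (fun i ↦ z ^ Q ^ i) k
  rw [Finset.sum_range_succ', hz, pow_zero, pow_one] at h1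
  simpa [← pow_mul, ← pow_succ'] using h1

/-- A double sum of iterated powers collapses to a single one. -/
theorem sum_sum_pow_pow {F : Type*} [CommRing F] (m n : ℕ) (z : F) :
    ∑ j ∈ Finset.range m, ∑ i ∈ Finset.range n, (z ^ (2 ^ m) ^ i) ^ 2 ^ j =
      ∑ i ∈ Finset.range (m * n), z ^ 2 ^ i := by
  rw [Finset.sum_comm]
  induction n with
  | zero => simp
  | succ n ih =>
    rw [Finset.sum_range_succ, ih, Nat.mul_succ, Finset.sum_range_add]
    simp only [← pow_mul, ← pow_add]

/-- If `n` is odd, a fixed point of the `n`-th and second iterates of `x ↦ x ^ q` is a fixed point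
of `x ↦ x ^ q`. -/
theorem pow_eq_self_of_odd {F : Type*} [Monoid F] {q n : ℕ} (hn : Odd n) {d : F}
    (h2 : (d ^ q) ^ q = d) (hd : d ^ q ^ n = d) : d ^ q = d := by
  obtain ⟨k, rfl⟩ := hn
  have h : ∀ k, d ^ q ^ (2 * k) = d := fun k ↦ by
    induction k with
    | zero => simp
    | succ k ih => rw [Nat.mul_succ, pow_add, pow_mul, ih, pow_two, pow_mul, h2]
  rwa [pow_succ, pow_mul, h] at hd

/-- The map `x ↦ Tr (x ^ (q + 1)) + L x` is injective iff `L` maps no element outside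
`W = {x | x ^ q = x}` into `W`, and `L w + w ^ 2` vanishes for no nonzero `w ∈ W`. -/
theorem injective_trace_pow_add_iff {F : Type*} [Field F] [CharP F 2] [Fintype F] {m n : ℕ}
    (hn : Odd n) (Tr L : F →+ F)
    (hq : ∀ x : F, x ^ (2 ^ m) ^ n = x)
    (hTrpow : ∀ x, Tr (x ^ 2 ^ m) = Tr x) (hTrfix : ∀ x, Tr x ^ 2 ^ m = Tr x)
    (hTrmul : ∀ c x, c ^ 2 ^ m = c → Tr (c * x) = c * Tr x) (hTrne : ∃ x, Tr x ≠ 0)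
    (hTrW : ∀ c, c ^ 2 ^ m = c → Tr c = c) :
    Function.Injective (fun x : F ↦ Tr (x ^ (2 ^ m + 1)) + L x) ↔
      (∀ d, L d ^ 2 ^ m = L d → d ^ 2 ^ m = d) ∧
        ∀ w, w ^ 2 ^ m = w → L w + w ^ 2 = 0 → w = 0 := by
  have hexp : ∀ x d, Tr ((x + d) ^ (2 ^ m + 1)) + L (x + d) =
      (Tr (x ^ (2 ^ m + 1)) + L x) +
        (Tr ((d + (d ^ 2 ^ m) ^ 2 ^ m) * x ^ 2 ^ m) + (Tr (d ^ (2 ^ m + 1)) + L d)) := by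
    intro x d
    have h1 : (x + d) ^ (2 ^ m + 1) =
        x ^ (2 ^ m + 1) + d * x ^ 2 ^ m + d ^ 2 ^ m * x + d ^ (2 ^ m + 1) := by
      rw [pow_succ, add_pow_char_pow]; ring
    have h2 : Tr ((d ^ 2 ^ m) ^ 2 ^ m * x ^ 2 ^ m) = Tr (d ^ 2 ^ m * x) := by
      rw [← mul_pow, hTrpow]
    rw [h1, add_mul, map_add, map_add, map_add, map_add, map_add, h2]
    abel
  have hinj : Function.Injective (fun x : F ↦ Tr (x ^ (2 ^ m + 1)) + L x) ↔
      ∀ x d, Tr ((d + (d ^ 2 ^ m) ^ 2 ^ m) * x ^ 2 ^ m) + (Tr (d ^ (2 ^ m + 1)) + L d) = 0 →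
        d = 0 := by
    constructor
    · intro h x d h0
      have h1 : (x + d) = x := h (by simp only [hexp, h0, add_zero])
      simpa using h1
    · intro h x y hxy
      have h1 := hexp y (x - y)
      rw [add_sub_cancel] at h1
      have h2 := h y (x - y) (by
        simp only at hxy
        rw [hxy] at h1
        exact left_eq_add.1 h1)
      exact sub_eq_zero.1 h2
  have hself : ∀ d : F, d ^ 2 ^ m = d → ∀ x,
      Tr ((d + (d ^ 2 ^ m) ^ 2 ^ m) * x ^ 2 ^ m) + (Tr (d ^ (2 ^ m + 1)) + L d) = L d + d ^ 2 := by
    intro d hd x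
    rw [pow_succ, hd, hd, CharTwo.add_self_eq_zero, zero_mul, map_zero, zero_add,
      hTrW (d * d) (by rw [mul_pow, hd]), pow_two, add_comm]
  rw [hinj]
  constructor
  · intro h
    refine ⟨fun d hd ↦ ?_, fun w hw h0 ↦ h 0 w (by rw [hself w hw, h0])⟩
    by_contra hne
    have hu : d + (d ^ 2 ^ m) ^ 2 ^ m ≠ 0 := fun h0 ↦
      hne (pow_eq_self_of_odd hn (CharTwo.add_eq_zero.1 h0).symm (hq d))
    set c := Tr (d ^ (2 ^ m + 1)) + L d with hc
    have hcW : c ^ 2 ^ m = c := by rw [hc, add_pow_char_pow, hTrfix, hd]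
    obtain ⟨z, hz⟩ := hTrne
    have hsurj : Function.Surjective (fun x : F ↦ x ^ 2 ^ m) :=
      (Finite.injective_iff_surjective).1 (iterateFrobenius_inj F 2 m)
    obtain ⟨x, hx⟩ := hsurj (c * (Tr z)⁻¹ * z / (d + (d ^ 2 ^ m) ^ 2 ^ m))
    have h1 := h x d (by
      simp only at hx
      rw [hx, mul_div_cancel₀ _ hu, hTrmul _ _ (by rw [mul_pow, inv_pow, hcW, hTrfix]),
        inv_mul_cancel_right₀ hz, ← hc, CharTwo.add_self_eq_zero])
    apply hne
    rw [h1, zero_pow (by positivity)]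
  · rintro ⟨h1, h2⟩ x d h0
    have hd : d ^ 2 ^ m = d := by
      refine h1 d ?_
      rw [← add_assoc, CharTwo.add_eq_zero, ← map_add] at h0
      rw [← h0, hTrfix]
    exact h2 d hd (by rw [← hself d hd x, h0])

/-- Let `n` be odd, `q = 2^m`, `F` the field with `q^n` elements, and `L` a
`2`-linear polynomial over `F` with coefficients `a i` and adjoint
`L'(x) = Σ_i (a i · x)^(2^(m·n - i))`.  Let `K = ker Tr` as an additive subgroup.  Then
`Tr(x^(q+1)) + L(x)` is a permutation polynomial of `F` iff `L'(ker Tr) = ker Tr` and the map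
`x ↦ L'(x) + x^(1/2)` (with `x^(1/2) = x^(2^(m·n - 1))`) induces an additive automorphism of
`F ⧸ K` via `α + K ↦ L'(α) + α^(1/2) + K`. -/
theorem stmt_8 (m n : ℕ) (hm : 0 < m) (hn : Odd n)
    (F : Type*) [Field F] [Fintype F] (hF : Fintype.card F = 2 ^ (m * n))
    (a : Fin (m * n) → F)
    (L L' Tr : F → F)
    (hL : ∀ x, L x = ∑ i : Fin (m * n), a i * x ^ 2 ^ (i : ℕ))
    (hL' : ∀ x, L' x = ∑ i : Fin (m * n), (a i * x) ^ 2 ^ (m * n - (i : ℕ)))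
    (hTr : ∀ x, Tr x = ∑ i ∈ Finset.range n, x ^ (2 ^ m) ^ i)
    (K : AddSubgroup F) (hK : ∀ x, x ∈ K ↔ Tr x = 0) :
    Function.Bijective (fun x : F => Tr (x ^ (2 ^ m + 1)) + L x) ↔
      (L' '' {x : F | Tr x = 0} = {x : F | Tr x = 0} ∧
        ∃ φ : F ⧸ K →+ F ⧸ K,
          (∀ α : F, φ (QuotientAddGroup.mk α) =
              QuotientAddGroup.mk (L' α + α ^ 2 ^ (m * n - 1))) ∧
          Function.Bijective φ) := by
  have : Fact (Nat.Prime 2) := ⟨Nat.prime_two⟩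
  have : CharP F 2 := charP_of_card_eq_prime_pow hF
  have hn0 : 0 < n := hn.pos
  have hmn : 0 < m * n := Nat.mul_pos hm hn0
  have hcard : ∀ x : F, x ^ 2 ^ (m * n) = x := fun x ↦ by rw [← hF, FiniteField.pow_card]
  have hq : ∀ x : F, x ^ (2 ^ m) ^ n = x := fun x ↦ by rw [← pow_mul, hcard]
  have hadd : ∀ (x y : F) (k : ℕ), (x + y) ^ 2 ^ k = x ^ 2 ^ k + y ^ 2 ^ k :=
    fun x y k ↦ add_pow_char_pow x y 2 k
  have hadd' : ∀ (x y : F) (k : ℕ), (x + y) ^ (2 ^ m) ^ k = x ^ (2 ^ m) ^ k + y ^ (2 ^ m) ^ k :=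
    fun x y k ↦ by rw [← pow_mul, hadd]
  have hfix : ∀ (c : F) (i : ℕ), c ^ 2 ^ m = c → c ^ (2 ^ m) ^ i = c := fun c i hc ↦ by
    induction i with
    | zero => simp
    | succ i ih => rw [pow_succ, pow_mul, ih, hc]
  have hTrfrob : ∀ (x : F) (k : ℕ), Tr (x ^ 2 ^ k) = Tr x ^ 2 ^ k := fun x k ↦ by
    rw [hTr, hTr, sum_pow_char_pow]
    exact Finset.sum_congr rfl fun i _ ↦ pow_right_comm _ _ _
  have hTrpow : ∀ x, Tr (x ^ 2 ^ m) = Tr x := fun x ↦ by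
    rw [hTr, hTr, sum_pow_pow_pow_eq (hq x)]
  have hTrfix : ∀ x, Tr x ^ 2 ^ m = Tr x := fun x ↦ by rw [← hTrfrob, hTrpow]
  have hTrmul : ∀ c x, c ^ 2 ^ m = c → Tr (c * x) = c * Tr x := fun c x hc ↦ by
    rw [hTr, hTr, Finset.mul_sum]
    exact Finset.sum_congr rfl fun i _ ↦ by rw [mul_pow, hfix c i hc]
  have hTrne : ∃ x, Tr x ≠ 0 := by
    simp only [hTr]
    exact exists_sum_pow_pow_ne_zero (Nat.one_lt_two_pow hm.ne') hn0 (by rw [hF, ← pow_mul])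
  have hTrW : ∀ c, c ^ 2 ^ m = c → Tr c = c := fun c hc ↦ by
    rw [hTr, Finset.sum_congr rfl fun i _ ↦ hfix c i hc, Finset.sum_const, Finset.card_range,
      nsmul_eq_mul, CharTwo.natCast_eq_ite, if_neg (Nat.not_even_iff_odd.2 hn), one_mul]
  let trH : F →+ F := AddMonoidHom.mk' Tr fun x y ↦ by
    simp only [hTr, hadd', Finset.sum_add_distrib]
  let LH : F →+ F := AddMonoidHom.mk' L fun x y ↦ by
    simp only [hL, hadd, mul_add, Finset.sum_add_distrib]
  let LH' : F →+ F := AddMonoidHom.mk' L' fun x y ↦ by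
    simp only [hL', hadd, mul_add, Finset.sum_add_distrib]
  let NH : F →+ F := AddMonoidHom.mk' (fun x ↦ L x + x ^ 2) fun x y ↦ by
    have h1 : L (x + y) = L x + L y := map_add LH x y
    have h2 := hadd x y 1
    rw [pow_one] at h2
    simp only [h1, h2]; abel
  let MH : F →+ F := AddMonoidHom.mk' (fun x ↦ L' x + x ^ 2 ^ (m * n - 1)) fun x y ↦ by
    have h1 : L' (x + y) = L' x + L' y := map_add LH' x y
    simp only [h1, hadd]; abel
  let T : F →+ F := AddMonoidHom.mk' (fun x ↦ ∑ i ∈ Finset.range (m * n), x ^ 2 ^ i)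
    fun x y ↦ by simp only [hadd, Finset.sum_add_distrib]
  let W : AddSubgroup F :=
    { carrier := {x | x ^ 2 ^ m = x}
      zero_mem' := zero_pow (by positivity)
      add_mem' := fun {x y} hx hy ↦ by
        simp only [Set.mem_ofPred_eq] at hx hy ⊢
        rw [hadd, hx, hy]
      neg_mem' := fun {x} hx ↦ by rwa [CharTwo.neg_eq] }
  have hTdef : ∀ x, T x = ∑ i ∈ Finset.range (m * n), x ^ 2 ^ i := fun x ↦ rfl
  have hTTr : ∀ x, T x = ∑ j ∈ Finset.range m, Tr x ^ 2 ^ j := fun x ↦ by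
    rw [hTdef, ← sum_sum_pow_pow]
    exact Finset.sum_congr rfl fun j _ ↦ by rw [hTr, sum_pow_char_pow]
  have hTpow : ∀ (k : ℕ) x, T (x ^ 2 ^ k) = T x := fun k ↦ by
    induction k with
    | zero => simp
    | succ k ih =>
      intro x
      rw [pow_succ, pow_mul, hTdef, sum_pow_pow_pow_eq (hcard _), ← hTdef, ih]
  obtain ⟨z, hz⟩ : ∃ z, T z ≠ 0 :=
    exists_sum_pow_pow_ne_zero (F := F) one_lt_two hmn hF.ge
  have hnd : ∀ d, (∀ x, T (x * d) = 0) → d = 0 := fun d h ↦ by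
    by_contra hd
    exact hz (by simpa [hd] using h (z / d))
  have hmemW : ∀ x, x ∈ W ↔ x ^ 2 ^ m = x := fun x ↦ Iff.rfl
  have hKset : {x : F | Tr x = 0} = (K : Set F) := Set.ext fun x ↦ (hK x).symm
  have hLL : ∀ x y, T (x * LH y) = T (LH' x * y) := fun x y ↦ by
    change T (x * L y) = T (L' x * y)
    rw [hL, hL', Finset.mul_sum, Finset.sum_mul, map_sum, map_sum]
    refine Finset.sum_congr rfl fun i _ ↦ ?_
    rw [← hTpow (m * n - (i : ℕ)) (x * _)]
    congr 1
    rw [← mul_assoc, mul_pow, ← pow_mul y, ← pow_add, Nat.add_sub_cancel' i.2.le, hcard,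
      mul_comm x]
  have hNM : ∀ x y, T (x * NH y) = T (MH x * y) := fun x y ↦ by
    change T (x * (L y + y ^ 2)) = T ((L' x + x ^ 2 ^ (m * n - 1)) * y)
    have h1 : T (x * L y) = T (L' x * y) := hLL x y
    rw [mul_add, add_mul, map_add, map_add, h1, ← hTpow (m * n - 1) (x * y ^ 2), mul_pow,
      ← pow_mul y, ← pow_succ', Nat.sub_add_cancel hmn, hcard]
  have hdual := adjoint_conditions_iff T LH NH LH' MH W K hLL hNM hnd
    (fun k hk w hw ↦ by
      rw [hTTr, mul_comm, hTrmul w k hw, (hK k).1 hk, mul_zero]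
      exact Finset.sum_eq_zero fun j _ ↦ zero_pow (by positivity))
    (fun x h ↦ by
      rw [hK]
      by_contra hx
      apply hz
      have h1 := h (Tr z / Tr x) (by rw [hmemW, div_pow, hTrfix, hTrfix])
      rwa [hTTr, mul_comm, hTrmul _ _ (by rw [div_pow, hTrfix, hTrfix]), div_mul_cancel₀ _ hx,
        ← hTTr] at h1)
    (fun d h ↦ by
      rw [hmemW]
      refine CharTwo.add_eq_zero.1 (hnd _ fun x ↦ ?_)
      have hsurj : Function.Surjective (fun x : F ↦ x ^ 2 ^ m) :=
        (Finite.injective_iff_surjective).1 (iterateFrobenius_inj F 2 m)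
      obtain ⟨y, rfl⟩ := hsurj x
      have h1 := h (y ^ 2 ^ m + y) (by
        have h2 : Tr (y ^ 2 ^ m + y) = Tr (y ^ 2 ^ m) + Tr y := map_add trH _ _
        rw [hK, h2, hTrpow, CharTwo.add_self_eq_zero])
      rw [add_mul, map_add, ← hTpow m (y * d), mul_pow] at h1
      rw [mul_add, map_add, add_comm]
      exact h1)
    (fun w hw ↦ by
      change L w + w ^ 2 - L w ∈ W
      rw [add_sub_cancel_left, hmemW, ← pow_mul, mul_comm, pow_mul, (hmemW w).1 hw])
    (fun k hk ↦ by
      change L' k + k ^ 2 ^ (m * n - 1) - L' k ∈ K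
      rw [add_sub_cancel_left, hK, hTrfrob, (hK k).1 hk, zero_pow (by positivity)])
  rw [hKset, ← Finite.injective_iff_bijective]
  exact (injective_trace_pow_add_iff hn trH LH hq hTrpow hTrfix hTrmul hTrne hTrW).trans hdual
end

section
/- Let n be odd and λ a 2-linear polynomial over F_{q^n}. If λ'(ker Tr) = ker Tr, Tr(λ'(x)) = Tr(x)^{1/2} for all x ∈ F_{q^n}, and ℓ is a 2-linear polynomial of degree less than q with coefficients in F_q that permutes F_q, then Tr(x^{q+1} + ℓ(x)) + λ(x) is a permutation polynomial of F_{q^n}. -/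
section SumPowTwo

variable {F : Type*} [Field F]

/-- The absolute trace of a field with `2 ^ N` elements, written as a sum of powers. -/
def sumPowTwo (N : ℕ) (x : F) : F := ∑ j ∈ Finset.range N, x ^ 2 ^ j

theorem sumPowTwo_add [CharP F 2] (N : ℕ) (x y : F) :
    sumPowTwo N (x + y) = sumPowTwo N x + sumPowTwo N y := by
  simp only [sumPowTwo, add_pow_char_pow, Finset.sum_add_distrib]

theorem sumPowTwo_zero (N : ℕ) : sumPowTwo N (0 : F) = 0 := by
  simp [sumPowTwo]

theorem sumPowTwo_sum [CharP F 2] (N : ℕ) {ι : Type*} (s : Finset ι) (f : ι → F) :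
    sumPowTwo N (∑ i ∈ s, f i) = ∑ i ∈ s, sumPowTwo N (f i) := by
  classical
  induction s using Finset.induction_on with
  | empty => simp [sumPowTwo_zero]
  | insert a s ha ih => rw [Finset.sum_insert ha, Finset.sum_insert ha, sumPowTwo_add, ih]

theorem sumPowTwo_sq {N : ℕ} {x : F} (hx : x ^ 2 ^ N = x) :
    sumPowTwo N (x ^ 2) = sumPowTwo N x := by
  have h1 := Finset.sum_range_succ (fun j => x ^ 2 ^ j) N
  have h2 := Finset.sum_range_succ' (fun j => x ^ 2 ^ j) N
  simp only [hx, pow_zero, pow_one] at h1 h2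
  simp only [sumPowTwo, ← pow_mul, ← pow_succ']
  exact add_right_cancel (h2.symm.trans h1)

theorem sumPowTwo_pow {N : ℕ} {x : F} (hx : x ^ 2 ^ N = x) (k : ℕ) :
    sumPowTwo N (x ^ 2 ^ k) = sumPowTwo N x := by
  induction k with
  | zero => simp
  | succ k ih => rw [pow_succ, pow_mul, sumPowTwo_sq (by rw [← pow_mul, mul_comm, pow_mul, hx]), ih]

theorem eq_zero_of_sumPowTwo_mul [Fintype F] (N : ℕ) (hN : 0 < N) (hF : Fintype.card F = 2 ^ N)
    (a : F) (h : ∀ z : F, sumPowTwo N (z * a) = 0) : a = 0 := by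
  by_contra ha
  have h0 : ∀ z : F, ∑ j ∈ Finset.range N, z ^ 2 ^ j = 0 := fun z => by
    simpa [sumPowTwo, ha] using h (z * a⁻¹)
  let p : Polynomial F := ∑ j ∈ Finset.range N, Polynomial.X ^ 2 ^ j
  have hp : p = 0 := by
    refine Polynomial.eq_zero_of_natDegree_lt_card_of_eval_eq_zero p (f := id)
      Function.injective_id (fun z => ?_) ?_
    · simpa [p, Polynomial.eval_finsetSum] using h0 z
    · rw [hF]
      refine lt_of_le_of_lt (Polynomial.natDegree_sum_le_of_forall_le (n := 2 ^ (N - 1)) _ _ ?_)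
        (Nat.pow_lt_pow_right (by norm_num) (by omega))
      intro j hj
      rw [Polynomial.natDegree_X_pow]
      have := Finset.mem_range.1 hj
      exact Nat.pow_le_pow_right (by norm_num) (by omega)
  have hc : p.coeff 1 = 1 := by
    simp only [p, Polynomial.finsetSum_coeff, Polynomial.coeff_X_pow]
    rw [Finset.sum_eq_single 0]
    · simp
    · intro j _ hj
      have : 1 < 2 ^ j := Nat.one_lt_two_pow hj
      rw [if_neg (by omega)]
    · intro hn
      exact absurd (Finset.mem_range.2 hN) hn
  rw [hp] at hc
  simp at hc

theorem eq_of_sumPowTwo_mul [Fintype F] [CharP F 2] (N : ℕ) (hN : 0 < N)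
    (hF : Fintype.card F = 2 ^ N) (a b : F)
    (h : ∀ z : F, sumPowTwo N (z * a) = sumPowTwo N (z * b)) : a = b := by
  have : a + b = 0 := eq_zero_of_sumPowTwo_mul N hN hF _ fun z => by
    rw [mul_add, sumPowTwo_add, h, CharTwo.add_self_eq_zero]
  exact CharTwo.add_eq_zero.1 this

/-- Transitivity of the trace. -/
theorem sumPowTwo_mul_eq [CharP F 2] (m n : ℕ) (x : F) :
    sumPowTwo (m * n) x =
      sumPowTwo m (∑ i ∈ Finset.range n, x ^ (2 ^ m) ^ i) := by
  rw [sumPowTwo_sum]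
  induction n with
  | zero => simp [sumPowTwo]
  | succ n ih =>
    rw [Finset.sum_range_succ, ← ih, Nat.mul_succ]
    simp only [sumPowTwo, Finset.sum_range_add]
    congr 1
    refine Finset.sum_congr rfl fun j _ => ?_
    rw [← pow_mul, ← pow_mul, pow_add]

theorem sumPowTwo_mul_adjoint [CharP F 2] (N : ℕ) (hN : ∀ x : F, x ^ 2 ^ N = x)
    (c : Fin N → F) (z a : F) :
    sumPowTwo N (z * ∑ i : Fin N, c i * a ^ 2 ^ (i : ℕ)) =
      sumPowTwo N ((∑ i : Fin N, (c i * z) ^ 2 ^ (N - (i : ℕ))) * a) := by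
  rw [Finset.mul_sum, Finset.sum_mul, sumPowTwo_sum, sumPowTwo_sum]
  refine Finset.sum_congr rfl fun i _ => ?_
  rw [← sumPowTwo_pow (hN (_ * a)) i, mul_pow, ← pow_mul, ← pow_add,
    Nat.sub_add_cancel i.2.le, hN]
  congr 1
  ring

end SumPowTwo

theorem pow_pow_eq_self {M : Type*} [Monoid M] {x : M} {k : ℕ} (hx : x ^ k = x) (i : ℕ) :
    x ^ k ^ i = x := by
  induction i with
  | zero => simp
  | succ i ih => rw [pow_succ, pow_mul, ih, hx]

/-- Let `n` be odd, `q = 2^m`, `F` the field with `q^n` elements, and `λ` a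
`2`-linear polynomial over `F` with adjoint `λ'`.  If `λ'(ker Tr) = ker Tr`,
`Tr(λ'(x)) = Tr(x)^(1/2)` for all `x` (square root realised as `y ↦ y^(2^(m·n-1))`), and `ℓ`
is a `2`-linear polynomial of degree less than `q` with coefficients in `F_q` permuting `F_q`,
then `Tr(x^(q+1) + ℓ(x)) + λ(x)` is a permutation polynomial of `F`. -/
theorem stmt_9 (m n : ℕ) (hm : 0 < m) (hn : Odd n)
    (F : Type*) [Field F] [Fintype F] (hF : Fintype.card F = 2 ^ (m * n))
    (lc : Fin (m * n) → F) (ec : Fin m → F)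
    (lam lam' Tr ell : F → F)
    (hlam : ∀ x, lam x = ∑ i : Fin (m * n), lc i * x ^ 2 ^ (i : ℕ))
    (hlam' : ∀ x, lam' x = ∑ i : Fin (m * n), (lc i * x) ^ 2 ^ (m * n - (i : ℕ)))
    (hTr : ∀ x, Tr x = ∑ i ∈ Finset.range n, x ^ (2 ^ m) ^ i)
    (h1 : lam' '' {x : F | Tr x = 0} = {x : F | Tr x = 0})
    (h2 : ∀ x, Tr (lam' x) = (Tr x) ^ 2 ^ (m * n - 1))
    (hec : ∀ i : Fin m, (ec i) ^ 2 ^ m = ec i)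
    (hell : ∀ x, ell x = ∑ i : Fin m, ec i * x ^ 2 ^ (i : ℕ))
    (hperm : Set.BijOn ell {x : F | x ^ 2 ^ m = x} {x : F | x ^ 2 ^ m = x}) :
    Function.Bijective (fun x : F => Tr (x ^ (2 ^ m + 1) + ell x) + lam x) := by
  have hN0 : 0 < m * n := Nat.mul_pos hm hn.pos
  have : CharP F 2 := charP_of_card_eq_prime_pow hF
  have hN : ∀ x : F, x ^ 2 ^ (m * n) = x := fun x => hF ▸ FiniteField.pow_card x
  set T : F → F := sumPowTwo (m * n) with hT
  have hTadd : ∀ x y, T (x + y) = T x + T y := sumPowTwo_add _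
  have hTrT : ∀ x, T x = sumPowTwo m (Tr x) := fun x => by
    rw [hTr, hT, sumPowTwo_mul_eq]
  have hTrq : ∀ x, Tr (x ^ 2 ^ m) = Tr x := fun x => by
    have e1 := Finset.sum_range_succ (fun i => x ^ (2 ^ m) ^ i) n
    have e2 := Finset.sum_range_succ' (fun i => x ^ (2 ^ m) ^ i) n
    simp only [pow_zero, pow_one, ← pow_mul 2 m n, hN] at e1 e2
    rw [hTr, hTr]
    simp only [← pow_mul x (2 ^ m), ← pow_succ']
    exact add_right_cancel (e2.symm.trans e1)
  have hTradd : ∀ x y, Tr (x + y) = Tr x + Tr y := fun x y => by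
    simp only [hTr, ← pow_mul, add_pow_char_pow, Finset.sum_add_distrib]
  have hTrFix : ∀ x, Tr x ^ 2 ^ m = Tr x := fun x => by
    conv_rhs => rw [← hTrq x]
    rw [hTr, hTr, sum_pow_char_pow]
    refine Finset.sum_congr rfl fun i _ => ?_
    rw [← pow_mul, mul_comm, pow_mul]
  have hTrmul : ∀ c x, c ^ 2 ^ m = c → Tr (c * x) = c * Tr x := fun c x hc => by
    simp only [hTr, mul_pow, pow_pow_eq_self hc, Finset.mul_sum]
  have hTr1 : ∀ c, c ^ 2 ^ m = c → Tr c = c := fun c hc => by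
    simp only [hTr, pow_pow_eq_self hc, Finset.sum_const, Finset.card_range, nsmul_eq_mul]
    rw [CharTwo.natCast_eq_ite, if_neg (Nat.not_even_iff_odd.2 hn), one_mul]
  have hlamadd : ∀ x y, lam (x + y) = lam x + lam y := fun x y => by
    simp only [hlam, add_pow_char_pow, mul_add, Finset.sum_add_distrib]
  have helladd : ∀ x y, ell (x + y) = ell x + ell y := fun x y => by
    simp only [hell, add_pow_char_pow, mul_add, Finset.sum_add_distrib]
  have hadj : ∀ z a, T (z * lam a) = T (lam' z * a) := fun z a => by
    rw [hlam, hlam', hT, sumPowTwo_mul_adjoint _ hN]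
  have hfix : ∀ a, lam a ^ 2 ^ m = lam a → a ^ 2 ^ m = a := fun a ha => by
    have hk : ∀ w, Tr w = 0 → T (w * a) = 0 := fun w hw => by
      obtain ⟨z, hz, rfl⟩ : w ∈ lam' '' {x : F | Tr x = 0} := by rw [h1]; exact hw
      rw [← hadj, mul_comm, hTrT, hTrmul _ _ ha, show Tr z = 0 from hz, mul_zero,
        sumPowTwo_zero]
    symm
    refine eq_of_sumPowTwo_mul _ hN0 hF _ _ fun z => ?_
    obtain ⟨w, rfl⟩ : ∃ w, w ^ 2 ^ m = z :=
      ⟨z ^ 2 ^ (m * n - m), by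
        rw [← pow_mul, ← pow_add, Nat.sub_add_cancel (Nat.le_mul_of_pos_right m hn.pos), hN]⟩
    have h := hk (w + w ^ 2 ^ m) (by rw [hTradd, hTrq, CharTwo.add_self_eq_zero])
    rw [add_mul, hTadd, CharTwo.add_eq_zero] at h
    rw [← mul_pow, sumPowTwo_pow (hN _)]
    exact h.symm
  have hsq : ∀ a, a ^ 2 ^ m = a → lam a = a ^ 2 := fun a ha => by
    refine eq_of_sumPowTwo_mul _ hN0 hF _ _ fun z => ?_
    have ha2 : (a ^ 2) ^ 2 ^ m = a ^ 2 := by rw [← pow_mul, mul_comm, pow_mul, ha]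
    change T _ = T _
    have hs2 : (Tr z ^ 2 ^ (m * n - 1)) ^ 2 = Tr z := by
      rw [← pow_mul, ← pow_succ, Nat.sub_add_cancel hN0, hN]
    have hs : (a * Tr z ^ 2 ^ (m * n - 1)) ^ 2 ^ m = a * Tr z ^ 2 ^ (m * n - 1) := by
      rw [mul_pow, ha, ← pow_mul, mul_comm (2 ^ _), pow_mul, hTrFix]
    rw [hadj, mul_comm _ a, hTrT, hTrmul _ _ ha, h2, ← sumPowTwo_sq hs, mul_pow, hs2,
      mul_comm z, hTrT, hTrmul _ _ ha2]
  rw [← Finite.injective_iff_bijective]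
  intro x y hxy
  obtain ⟨a, rfl⟩ : ∃ a, y = x + a := ⟨y - x, by ring⟩
  simp only [hlamadd, helladd] at hxy
  have hla : lam a = Tr (x ^ (2 ^ m + 1) + ell x + ((x + a) ^ (2 ^ m + 1) + (ell x + ell a))) := by
    rw [hTradd]
    linear_combination hxy + CharTwo.add_self_eq_zero (lam a) -
      CharTwo.add_self_eq_zero (Tr (x ^ (2 ^ m + 1) + ell x))
  have ha : a ^ 2 ^ m = a := hfix a (by rw [hla, hTrFix])
  have hella : ell a ^ 2 ^ m = ell a := hperm.mapsTo ha
  have hell0 : ell a = 0 := by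
    have ha2 : (a ^ 2) ^ 2 ^ m = a ^ 2 := by rw [← pow_mul, mul_comm, pow_mul, ha]
    have e : (x + a) ^ (2 ^ m + 1) = x ^ (2 ^ m + 1) + (a * x ^ 2 ^ m + (a * x + a ^ 2)) := by
      rw [pow_succ, add_pow_char_pow, ha]
      ring
    rw [hsq a ha, e] at hxy
    simp only [hTradd, hTrmul _ _ ha, hTr1 _ ha2, hTr1 _ hella, hTrq] at hxy
    linear_combination -hxy - CharTwo.add_self_eq_zero (a * Tr x) -
      CharTwo.add_self_eq_zero (a ^ 2)
  have ha0 : a = 0 := by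
    refine hperm.injOn ha (show (0 : F) ^ 2 ^ m = 0 from zero_pow (by positivity)) ?_
    rw [hell0, hell]
    simp
  rw [ha0, add_zero]
end

section
/- Let n be odd and L, λ be 2-linear polynomials over F_{q^n}. If L'(ker Tr) = ker Tr, λ'(ker Tr) = ker Tr, and Tr(λ'(x)) = 0 for all x ∈ F_{q^n}, then both Tr(x^{q+1}) + L(λ(x)) and Tr(x^{q+1}) + λ(L(x)) are permutation polynomials of F_{q^n}. -/
open Finset

/-- The absolute trace form on a finite field of characteristic two is nondegenerate. -/
theorem eq_zero_of_forall_trace_mul_eq_zero {F : Type*} [Field F] [Fintype F]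
    [Algebra (ZMod 2) F] {z : F}
    (h : ∀ w, Algebra.trace (ZMod 2) F (w * z) = 0) : z = 0 :=
  (traceForm_nondegenerate (ZMod 2) F).1 z fun w => by
    rw [Algebra.traceForm_apply, mul_comm]; exact h w

/-- The absolute trace is invariant under powers of Frobenius. -/
theorem trace_pow_two_pow {F : Type*} [Field F] [Fintype F]
    [Algebra (ZMod 2) F] (x : F) (k : ℕ) :
    Algebra.trace (ZMod 2) F (x ^ 2 ^ k) = Algebra.trace (ZMod 2) F x := by
  induction k generalizing x with
  | zero => simp
  | succ k ih =>
    rw [pow_succ, pow_mul, ← ih x]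
    have := Algebra.trace_eq_of_algEquiv
      (FiniteField.frobeniusAlgEquivOfAlgebraic (ZMod 2) F) (x ^ 2 ^ k)
    simpa using this

/-- The adjoint relation between a `2`-linear polynomial and its formal adjoint. -/
theorem trace_mul_twoLinear_eq {F : Type*} [Field F] [Fintype F]
    [Algebra (ZMod 2) F] {N : ℕ} (hF : Fintype.card F = 2 ^ N)
    (a : Fin N → F) (x y : F) :
    Algebra.trace (ZMod 2) F (y * ∑ i : Fin N, a i * x ^ 2 ^ (i : ℕ)) =
      Algebra.trace (ZMod 2) F ((∑ i : Fin N, (a i * y) ^ 2 ^ (N - (i : ℕ))) * x) := by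
  rw [mul_sum, sum_mul, map_sum, map_sum]
  refine sum_congr rfl fun i _ => ?_
  have hx : (x ^ 2 ^ (i : ℕ)) ^ 2 ^ (N - (i : ℕ)) = x := by
    rw [← pow_mul, ← pow_add, Nat.add_sub_cancel' i.2.le, ← hF, FiniteField.pow_card]
  rw [← trace_pow_two_pow _ (N - (i : ℕ)), ← mul_assoc, mul_pow, hx, mul_comm y]

theorem twoLinear_add {F : Type*} [Field F] [CharP F 2]
    {N : ℕ} (a : Fin N → F) (x y : F) :
    ∑ i : Fin N, a i * (x + y) ^ 2 ^ (i : ℕ) =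
      ∑ i : Fin N, a i * x ^ 2 ^ (i : ℕ) + ∑ i : Fin N, a i * y ^ 2 ^ (i : ℕ) := by
  simp only [add_pow_char_pow, mul_add, sum_add_distrib]

theorem relTrace_add {F : Type*} [Field F] [CharP F 2]
    (m n : ℕ) (x y : F) :
    ∑ i ∈ range n, (x + y) ^ (2 ^ m) ^ i =
      ∑ i ∈ range n, x ^ (2 ^ m) ^ i + ∑ i ∈ range n, y ^ (2 ^ m) ^ i := by
  simp only [← pow_mul, add_pow_char_pow, sum_add_distrib]

theorem relTrace_mul_of_fixed {F : Type*} [Field F]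
    {m : ℕ} (n : ℕ) {c : F} (hc : c ^ 2 ^ m = c) (x : F) :
    ∑ i ∈ range n, (x * c) ^ (2 ^ m) ^ i = (∑ i ∈ range n, x ^ (2 ^ m) ^ i) * c := by
  have hci (i : ℕ) : c ^ (2 ^ m) ^ i = c := by
    induction i with
    | zero => simp
    | succ i ih => rw [pow_succ, pow_mul, ih, hc]
  simp only [mul_pow, hci, sum_mul]

theorem relTrace_frobenius {F : Type*} [Field F] [Fintype F]
    {m n : ℕ} (hF : Fintype.card F = 2 ^ (m * n)) (x : F) :
    ∑ i ∈ range n, (x ^ 2 ^ m) ^ (2 ^ m) ^ i = ∑ i ∈ range n, x ^ (2 ^ m) ^ i := by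
  have h := (sum_range_succ (fun i => x ^ (2 ^ m) ^ i) n).symm.trans (sum_range_succ' _ n)
  have hx : x ^ (2 ^ m) ^ n = x := by rw [← pow_mul, ← hF, FiniteField.pow_card]
  simp only [hx, pow_zero, pow_one] at h
  rw [add_right_cancel h]
  exact sum_congr rfl fun i _ => by rw [← pow_mul, ← pow_succ']

theorem relTrace_pow_eq_self {F : Type*} [Field F] [Fintype F] [CharP F 2]
    {m n : ℕ} (hF : Fintype.card F = 2 ^ (m * n)) (x : F) :
    (∑ i ∈ range n, x ^ (2 ^ m) ^ i) ^ 2 ^ m = ∑ i ∈ range n, x ^ (2 ^ m) ^ i := by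
  rw [sum_pow_char_pow]
  refine Eq.trans (sum_congr rfl fun i _ => ?_) (relTrace_frobenius hF x)
  exact pow_right_comm _ _ _

theorem relTrace_of_fixed {F : Type*} [Field F] [Fintype F] [CharP F 2]
    {m n : ℕ} (hn : Odd n) {c : F} (hc : c ^ 2 ^ m = c) :
    ∑ i ∈ range n, c ^ (2 ^ m) ^ i = c := by
  have hn1 : (n : F) = 1 := by
    obtain ⟨k, rfl⟩ := hn
    simp [CharTwo.two_eq_zero]
  simpa [hn1] using relTrace_mul_of_fixed n hc 1

/-- For odd `n`, the absolute trace vanishes on the kernel of the relative trace. -/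
theorem trace_eq_zero_of_relTrace_eq_zero {F : Type*} [Field F] [Fintype F]
    [Algebra (ZMod 2) F] {m n : ℕ} (hn : Odd n) {x : F}
    (hx : ∑ i ∈ range n, x ^ (2 ^ m) ^ i = 0) : Algebra.trace (ZMod 2) F x = 0 := by
  have hn1 : (n : ZMod 2) = 1 := by
    obtain ⟨k, rfl⟩ := hn
    simp [CharTwo.two_eq_zero]
  have h := congrArg (Algebra.trace (ZMod 2) F) hx
  simpa [← pow_mul, trace_pow_two_pow, hn1] using h

/-- For odd `n`, the subfield fixed by the `q`-power Frobenius is the orthogonal complement of the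
kernel of the relative trace. -/
theorem fixed_iff_forall_trace_mul_eq_zero {F : Type*} [Field F] [Fintype F] [CharP F 2]
    [Algebra (ZMod 2) F] {m n : ℕ} (hn : Odd n)
    (hF : Fintype.card F = 2 ^ (m * n)) (z : F) :
    z ^ 2 ^ m = z ↔ ∀ y : F, ∑ i ∈ range n, y ^ (2 ^ m) ^ i = 0 →
      Algebra.trace (ZMod 2) F (y * z) = 0 := by
  refine ⟨fun hz y hy => trace_eq_zero_of_relTrace_eq_zero (m := m) hn ?_, fun h => ?_⟩
  · rw [relTrace_mul_of_fixed n hz, hy, zero_mul]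
  · rw [← CharTwo.add_eq_zero]
    refine eq_zero_of_forall_trace_mul_eq_zero fun v => ?_
    obtain ⟨w, rfl⟩ : ∃ w : F, w ^ 2 ^ m = v := (bijective_iterateFrobenius F 2 m).2 v
    have hw := h (w ^ 2 ^ m + w) (by
      rw [relTrace_add, relTrace_frobenius hF, CharTwo.add_self_eq_zero])
    rw [add_mul, map_add] at hw
    rw [mul_add, map_add, ← mul_pow, trace_pow_two_pow, add_comm, hw]

/-- A function differing from the quadratic form `Tr (x ^ (q + 1))` by an additive map that vanishes
on `𝔽_q` and attains values in `𝔽_q` only there is a permutation. -/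
theorem bijective_relTrace_add {F : Type*} [Field F] [Fintype F] [CharP F 2]
    {m n : ℕ} (hn : Odd n) (hF : Fintype.card F = 2 ^ (m * n))
    {g : F → F} (hadd : ∀ x y, g (x + y) = g x + g y) (hzero : ∀ c, c ^ 2 ^ m = c → g c = 0)
    (hfix : ∀ d, g d ^ 2 ^ m = g d → d ^ 2 ^ m = d) :
    Function.Bijective fun x : F => ∑ i ∈ range n, (x ^ (2 ^ m + 1)) ^ (2 ^ m) ^ i + g x := by
  refine Finite.injective_iff_bijective.1 fun x y hxy => ?_
  obtain ⟨d, rfl⟩ : ∃ d, y = x + d := ⟨y - x, by ring⟩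
  have hd : d ^ 2 ^ m = d := by
    apply hfix
    have hgd : g d = ∑ i ∈ range n, (x ^ (2 ^ m + 1)) ^ (2 ^ m) ^ i +
        ∑ i ∈ range n, ((x + d) ^ (2 ^ m + 1)) ^ (2 ^ m) ^ i := by
      rw [hadd] at hxy
      rw [← CharTwo.sub_eq_add]
      linear_combination -hxy
    rw [hgd, ← relTrace_add]
    exact relTrace_pow_eq_self hF _
  have hexp : (x + d) ^ (2 ^ m + 1) = x ^ (2 ^ m + 1) + ((x ^ 2 ^ m + x) * d + d * d) := by
    rw [pow_succ, add_pow_char_pow, hd]; ring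
  have hdd : (d * d) ^ 2 ^ m = d * d := by rw [mul_pow, hd]
  rw [hadd, hzero d hd, add_zero, hexp, relTrace_add, relTrace_add, relTrace_mul_of_fixed n hd,
    relTrace_add, relTrace_frobenius hF, CharTwo.add_self_eq_zero, zero_mul, zero_add,
    relTrace_of_fixed hn hdd] at hxy
  have : d * d = 0 := by linear_combination -hxy
  rw [mul_self_eq_zero.1 this, add_zero]

/-- Let `n` be odd, `q = 2^m`, `F` the field with `q^n` elements, and `L`, `λ`
`2`-linear polynomials over `F` with adjoints `L'`, `λ'`.  If `L'(ker Tr) = ker Tr`,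
`λ'(ker Tr) = ker Tr` and `Tr(λ'(x)) = 0` for all `x`, then both `Tr(x^(q+1)) + L(λ(x))` and
`Tr(x^(q+1)) + λ(L(x))` are permutation polynomials of `F`. -/
theorem stmt_10 (m n : ℕ) (hm : 0 < m) (hn : Odd n)
    (F : Type*) [Field F] [Fintype F] (hF : Fintype.card F = 2 ^ (m * n))
    (Lc lc : Fin (m * n) → F)
    (L L' lam lam' Tr : F → F)
    (hL : ∀ x, L x = ∑ i : Fin (m * n), Lc i * x ^ 2 ^ (i : ℕ))
    (hL' : ∀ x, L' x = ∑ i : Fin (m * n), (Lc i * x) ^ 2 ^ (m * n - (i : ℕ)))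
    (hlam : ∀ x, lam x = ∑ i : Fin (m * n), lc i * x ^ 2 ^ (i : ℕ))
    (hlam' : ∀ x, lam' x = ∑ i : Fin (m * n), (lc i * x) ^ 2 ^ (m * n - (i : ℕ)))
    (hTr : ∀ x, Tr x = ∑ i ∈ Finset.range n, x ^ (2 ^ m) ^ i)
    (h1 : L' '' {x : F | Tr x = 0} = {x : F | Tr x = 0})
    (h2 : lam' '' {x : F | Tr x = 0} = {x : F | Tr x = 0})
    (h3 : ∀ x, Tr (lam' x) = 0) :
    Function.Bijective (fun x : F => Tr (x ^ (2 ^ m + 1)) + L (lam x)) ∧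
    Function.Bijective (fun x : F => Tr (x ^ (2 ^ m + 1)) + lam (L x)) := by
  have : CharP F 2 := charP_of_card_eq_prime_pow hF
  let : Algebra (ZMod 2) F := ZMod.algebra F 2
  have hfixed := fixed_iff_forall_trace_mul_eq_zero (m := m) hn hF
  simp only [← hTr] at hfixed
  have hLadd x y : L (x + y) = L x + L y := by simp only [hL, twoLinear_add]
  have hlamadd x y : lam (x + y) = lam x + lam y := by simp only [hlam, twoLinear_add]
  have hLadj x y : Algebra.trace (ZMod 2) F (y * L x) = Algebra.trace (ZMod 2) F (L' y * x) := by
    rw [hL, hL', trace_mul_twoLinear_eq hF]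
  have hlamadj x y :
      Algebra.trace (ZMod 2) F (y * lam x) = Algebra.trace (ZMod 2) F (lam' y * x) := by
    rw [hlam, hlam', trace_mul_twoLinear_eq hF]
  have hLfix x : L x ^ 2 ^ m = L x ↔ x ^ 2 ^ m = x := by
    simp only [hfixed, hLadj]
    simpa using (Set.forall_mem_image (f := L') (s := {x | Tr x = 0})
      (p := fun y => Algebra.trace (ZMod 2) F (y * x) = 0)).symm.trans (by rw [h1]; rfl)
  have hlamfix x : lam x ^ 2 ^ m = lam x ↔ x ^ 2 ^ m = x := by
    simp only [hfixed, hlamadj]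
    simpa using (Set.forall_mem_image (f := lam') (s := {x | Tr x = 0})
      (p := fun y => Algebra.trace (ZMod 2) F (y * x) = 0)).symm.trans (by rw [h2]; rfl)
  have hlamzero c (hc : c ^ 2 ^ m = c) : lam c = 0 :=
    eq_zero_of_forall_trace_mul_eq_zero fun w => by
      rw [hlamadj]; exact (hfixed c).1 hc _ (h3 w)
  have hLzero : L 0 = 0 := by simpa using hLadd 0 0
  simp only [hTr]
  constructor
  · refine bijective_relTrace_add hn hF (fun x y => by rw [hlamadd, hLadd])
      (fun c hc => by rw [hlamzero c hc, hLzero]) fun d hd => ?_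
    exact (hlamfix d).1 ((hLfix _).1 hd)
  · refine bijective_relTrace_add hn hF (fun x y => by rw [hLadd, hlamadd])
      (fun c hc => hlamzero _ ((hLfix c).2 hc)) fun d hd => ?_
    exact (hLfix d).1 ((hlamfix _).1 hd)
end

section
/- Let n be odd and L a 2-linear polynomial over F_{q^n}. If Tr(x^{q+1}) + L(x) is a permutation polynomial of F_{q^n}, then the kernel of the F_2-linear map induced by L on F_{q^n} has at most q elements, i.e. |ker L| ≤ q. -/
open Polynomial in
/-- In a finite field, at most `q` elements satisfy `y ^ q = y`. -/
theorem card_filter_pow_eq_self_le {F : Type*} [Field F] [Fintype F] [DecidableEq F]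
    {q : ℕ} (hq : 1 < q) : (Finset.univ.filter fun y : F => y ^ q = y).card ≤ q := by
  have hne : (X ^ q - X : F[X]) ≠ 0 := FiniteField.X_pow_card_sub_X_ne_zero F hq
  have hsub : (Finset.univ.filter fun y : F => y ^ q = y) ⊆ (X ^ q - X : F[X]).roots.toFinset := by
    intro y hy
    simpa [hne, sub_eq_zero] using hy
  calc _ ≤ (X ^ q - X : F[X]).roots.toFinset.card := Finset.card_le_card hsub
    _ ≤ Multiset.card (X ^ q - X : F[X]).roots := Multiset.toFinset_card_le _
    _ ≤ (X ^ q - X : F[X]).natDegree := card_roots' _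
    _ = q := FiniteField.X_pow_card_sub_X_natDegree_eq F hq

/-- The values of the trace `∑ y ^ q ^ i` are fixed by `y ↦ y ^ q`, for `q` a power of `p`. -/
theorem sum_pow_pow_eq_self {F : Type*} [Field F] [Fintype F] (p m n : ℕ) [Fact p.Prime] [CharP F p]
    (hF : Fintype.card F = (p ^ m) ^ n) (y : F) :
    (∑ i ∈ Finset.range n, y ^ (p ^ m) ^ i) ^ p ^ m = ∑ i ∈ Finset.range n, y ^ (p ^ m) ^ i := by
  have hy : y ^ (p ^ m) ^ n = y := by rw [← hF, FiniteField.pow_card]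
  rw [sum_pow_char_pow]
  have hstep (i : ℕ) : (y ^ (p ^ m) ^ i) ^ p ^ m = y ^ (p ^ m) ^ (i + 1) := by
    rw [pow_succ (p ^ m), pow_mul y]
  simp_rw [hstep]
  have h := Finset.sum_range_succ' (fun i => y ^ (p ^ m) ^ i) n
  rw [Finset.sum_range_succ, hy, pow_zero, pow_one] at h
  exact (add_right_cancel h).symm

/-- Let `n` be odd, `q = 2^m`, `F` the field with `q^n` elements, and `L` a
`2`-linear polynomial over `F`.  If `Tr(x^(q+1)) + L(x)` is a permutation polynomial of `F`,
then the kernel of the `F_2`-linear map induced by `L` has at most `q` elements. -/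
theorem stmt_11 (m n : ℕ) (hm : 0 < m) (hn : Odd n)
    (F : Type*) [Field F] [Fintype F] (hF : Fintype.card F = 2 ^ (m * n))
    (a : Fin (m * n) → F)
    (L Tr : F → F)
    (hL : ∀ x, L x = ∑ i : Fin (m * n), a i * x ^ 2 ^ (i : ℕ))
    (hTr : ∀ x, Tr x = ∑ i ∈ Finset.range n, x ^ (2 ^ m) ^ i)
    (hbij : Function.Bijective (fun x : F => Tr (x ^ (2 ^ m + 1)) + L x)) :
    Nat.card {x : F // L x = 0} ≤ 2 ^ m := by
  classical
  have : Fact (Nat.Prime 2) := ⟨Nat.prime_two⟩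
  have : CharP F 2 := charP_of_card_eq_prime_pow hF
  rw [Nat.card_eq_fintype_card, Fintype.card_subtype]
  refine le_trans (Finset.card_le_card_of_injOn (fun x => Tr (x ^ (2 ^ m + 1))) ?_ ?_)
    (card_filter_pow_eq_self_le (F := F) (Nat.one_lt_two_pow hm.ne'))
  · intro x _
    simpa [hTr] using sum_pow_pow_eq_self 2 m n (by rw [hF, pow_mul]) (x ^ (2 ^ m + 1))
  · intro x hx y hy hxy
    have hx0 : L x = 0 := by simpa using hx
    have hy0 : L y = 0 := by simpa using hy
    apply hbij.injective
    simpa [hx0, hy0] using hxy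
end

section
/- Let n be odd, L a 2-linear polynomial over F_{q^n} such that Tr(x^{q+1}) + L(x) is a permutation polynomial of F_{q^n}, and λ a 2-linear polynomial over F_{q^n} such that the map x ↦ x + Tr(λ'(x)) is a bijection of F_q. Then both Tr(x^{q+1}) + L(x) + L(Tr(λ(x))) + Tr(λ(x))^2 and Tr(x^{q+1}) + L(x) + Tr(λ(L(x))) + Tr(λ(x^2)) are permutation polynomials of F_{q^n}. -/
/-- The sum `x + x ^ q + ⋯ + x ^ q ^ (n - 1)`: the trace from `F_{q^n}` to `F_q`. -/
def powTrace {F : Type*} [Field F] (q n : ℕ) (x : F) : F :=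
  ∑ i ∈ Finset.range n, x ^ q ^ i

section PowTrace

variable {F : Type*} [Field F]

lemma pow_pow_eq_self_s13 {q : ℕ} {x : F} (hx : x ^ q = x) (i : ℕ) : x ^ q ^ i = x := by
  induction i with
  | zero => simp
  | succ i ih => rw [pow_succ, pow_mul, ih, hx]

lemma powTrace_pow {q n : ℕ} {x : F} (hx : x ^ q ^ n = x) :
    powTrace q n (x ^ q) = powTrace q n x := by
  have h : powTrace q n (x ^ q) = ∑ i ∈ Finset.range n, x ^ q ^ (i + 1) :=
    Finset.sum_congr rfl fun i _ => by rw [← pow_mul, pow_succ']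
  have h' := (Finset.sum_range_succ' (fun i => x ^ q ^ i) n).symm.trans
    (Finset.sum_range_succ (fun i => x ^ q ^ i) n)
  simp only [hx, pow_zero, pow_one] at h'
  rw [h]
  exact add_right_cancel h'

lemma powTrace_pow_pow {q n : ℕ} (hF : ∀ x : F, x ^ q ^ n = x) (k : ℕ) (x : F) :
    powTrace q n (x ^ q ^ k) = powTrace q n x := by
  induction k with
  | zero => simp
  | succ k ih => rw [pow_succ, pow_mul, powTrace_pow (hF _), ih]

lemma powTrace_mul {q : ℕ} (n : ℕ) {k : F} (hk : k ^ q = k) (x : F) :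
    powTrace q n (k * x) = k * powTrace q n x := by
  simp only [powTrace, Finset.mul_sum, mul_pow, pow_pow_eq_self_s13 hk]

lemma powTrace_powTrace [CharP F 2] (m n : ℕ) (x : F) :
    powTrace 2 m (powTrace (2 ^ m) n x) = powTrace 2 (m * n) x := by
  induction n with
  | zero => simp [powTrace]
  | succ n ih =>
    rw [Nat.mul_succ]
    simp only [powTrace] at ih ⊢
    rw [Finset.sum_range_add _ (m * n) m, ← ih, ← Finset.sum_add_distrib]
    refine Finset.sum_congr rfl fun i _ => ?_
    rw [Finset.sum_range_succ, add_pow_char_pow, ← pow_mul, ← pow_mul, ← pow_add]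

lemma powTrace_add [CharP F 2] (m n : ℕ) (x y : F) :
    powTrace (2 ^ m) n (x + y) = powTrace (2 ^ m) n x + powTrace (2 ^ m) n y := by
  simp only [powTrace, ← Finset.sum_add_distrib, ← pow_mul, add_pow_char_pow]

lemma powTrace_sum [CharP F 2] (m n : ℕ) {ι : Type*} (s : Finset ι) (f : ι → F) :
    powTrace (2 ^ m) n (∑ i ∈ s, f i) = ∑ i ∈ s, powTrace (2 ^ m) n (f i) := by
  simp only [powTrace, ← pow_mul, sum_pow_char_pow]
  exact Finset.sum_comm

lemma powTrace_pow_self [CharP F 2] {m n : ℕ} {x : F} (hx : x ^ (2 ^ m) ^ n = x) :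
    powTrace (2 ^ m) n x ^ 2 ^ m = powTrace (2 ^ m) n x := by
  refine Eq.trans ?_ (powTrace_pow hx)
  simp only [powTrace, sum_pow_char_pow]
  exact Finset.sum_congr rfl fun i _ => by rw [← pow_mul, ← pow_mul, ← pow_mul, mul_comm]

lemma powTrace_of_pow_eq_self [CharP F 2] {q n : ℕ} (hn : Odd n) {x : F} (hx : x ^ q = x) :
    powTrace q n x = x := by
  simp [powTrace, pow_pow_eq_self_s13 hx, CharTwo.natCast_eq_ite, Nat.not_even_iff_odd.2 hn]

lemma pow_two_pow_eq_self_of_pow_pow [CharP F 2] {m n : ℕ} (hn : Odd n) {x : F}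
    (hx : x ^ (2 ^ m) ^ n = x) (h : (x ^ 2 ^ m) ^ 2 ^ m = x) : x ^ 2 ^ m = x := by
  obtain ⟨k, rfl⟩ := hn
  have h' : x ^ ((2 ^ m) ^ 2) = x := by rwa [sq, pow_mul]
  have := pow_pow_eq_self_s13 h' k
  rw [pow_succ, pow_mul, pow_mul, this] at hx
  exact hx

/-- The absolute trace form of a finite field of characteristic two is nondegenerate. -/
lemma eq_zero_of_powTrace_mul_eq_zero [Fintype F] [CharP F 2] {N : ℕ}
    (hF : Fintype.card F = 2 ^ N) {a : F} (h : ∀ b, powTrace 2 N (a * b) = 0) : a = 0 := by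
  let : Algebra (ZMod 2) F := ZMod.algebra F 2
  have hfin : Module.finrank (ZMod 2) F = N := by
    have := Module.card_eq_pow_finrank (K := ZMod 2) (V := F)
    rw [hF, ZMod.card] at this
    exact (Nat.pow_right_injective le_rfl this).symm
  refine (traceForm_nondegenerate (ZMod 2) F).1 a fun b => ?_
  apply (algebraMap (ZMod 2) F).injective
  rw [Algebra.traceForm_apply, FiniteField.algebraMap_trace_eq_sum_pow, hfin, map_zero,
    Nat.card_zmod]
  exact h b

lemma powTrace_two_add [CharP F 2] (N : ℕ) (x y : F) :
    powTrace 2 N (x + y) = powTrace 2 N x + powTrace 2 N y := by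
  simpa using powTrace_add 1 N x y

/-- The relative trace is self-adjoint for the absolute trace form. -/
lemma powTrace_mul_powTrace [CharP F 2] {m n : ℕ} (hF : ∀ x : F, x ^ (2 ^ m) ^ n = x) (a b : F) :
    powTrace 2 (m * n) (a * powTrace (2 ^ m) n b) =
      powTrace 2 (m * n) (powTrace (2 ^ m) n a * b) := by
  rw [← powTrace_powTrace, ← powTrace_powTrace, powTrace_mul n (powTrace_pow_self (hF a)),
    mul_comm a, powTrace_mul n (powTrace_pow_self (hF b)), mul_comm]

/-- The adjoint of a `2`-linear polynomial is its adjoint for the absolute trace form. -/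
lemma powTrace_mul_adjoint [CharP F 2] {N : ℕ} (hF : ∀ x : F, x ^ 2 ^ N = x) (c : Fin N → F)
    (a b : F) :
    powTrace 2 N (a * ∑ i : Fin N, c i * b ^ 2 ^ (i : ℕ)) =
      powTrace 2 N ((∑ i : Fin N, (c i * a) ^ 2 ^ (N - (i : ℕ))) * b) := by
  have key : ∀ s : Finset (Fin N), ∀ f : Fin N → F,
      powTrace 2 N (∑ i ∈ s, f i) = ∑ i ∈ s, powTrace 2 N (f i) := by
    simpa using fun s f => powTrace_sum (F := F) 1 N s f
  rw [Finset.mul_sum, Finset.sum_mul, key, key]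
  refine Finset.sum_congr rfl fun i _ => ?_
  rw [← powTrace_pow_pow hF (N - i), ← mul_assoc, mul_pow, ← pow_mul, ← pow_add,
    Nat.add_sub_cancel' i.2.le, hF, mul_comm a]

/-- If `x ↦ x + Tr (λ' x)` maps `F_q` onto itself, then `x ↦ x + Tr (λ x)` has trivial kernel. -/
lemma eq_zero_of_add_powTrace_eq_zero [Fintype F] [CharP F 2] {m n : ℕ} (hn : Odd n)
    (hF : Fintype.card F = 2 ^ (m * n)) {lam lam' : F → F}
    (hadj : ∀ a b, powTrace 2 (m * n) (a * lam b) = powTrace 2 (m * n) (lam' a * b))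
    (hsurj : ∀ b : F, b ^ 2 ^ m = b → ∃ a, a ^ 2 ^ m = a ∧ a + powTrace (2 ^ m) n (lam' a) = b)
    {w : F} (hw : w + powTrace (2 ^ m) n (lam w) = 0) : w = 0 := by
  have hpow : ∀ x : F, x ^ (2 ^ m) ^ n = x := fun x => by
    rw [← pow_mul, ← hF, FiniteField.pow_card]
  have hw' : powTrace (2 ^ m) n (lam w) = w := (CharTwo.add_eq_zero.1 hw).symm
  have hwK : w ^ 2 ^ m = w := by rw [← hw', powTrace_pow_self (hpow _)]
  refine eq_zero_of_powTrace_mul_eq_zero hF fun z => ?_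
  obtain ⟨a, ha, haz⟩ := hsurj _ (powTrace_pow_self (hpow z))
  have haw : powTrace 2 (m * n) (a * w) = powTrace 2 (m * n) (a * lam w) := by
    have := powTrace_mul_powTrace hpow a (lam w)
    rwa [hw', powTrace_of_pow_eq_self hn ha] at this
  have htr : ∀ y, powTrace 2 (m * n) (powTrace (2 ^ m) n y * w) = powTrace 2 (m * n) (y * w) :=
    fun y => by rw [← powTrace_mul_powTrace hpow, powTrace_of_pow_eq_self hn hwK]
  rw [mul_comm w, ← htr, ← haz, add_mul, powTrace_two_add, htr, ← hadj, haw,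
    CharTwo.add_self_eq_zero]

lemma powTrace_pow_succ_add [CharP F 2] {m n : ℕ} (x u : F) :
    powTrace (2 ^ m) n ((x + u) ^ (2 ^ m + 1)) = powTrace (2 ^ m) n (x ^ (2 ^ m + 1)) +
      powTrace (2 ^ m) n (x ^ 2 ^ m * u + x * u ^ 2 ^ m) +
        powTrace (2 ^ m) n (u ^ (2 ^ m + 1)) := by
  rw [← powTrace_add, ← powTrace_add]
  congr 1
  rw [pow_succ, add_pow_char_pow]
  ring

lemma powTrace_pow_mul_add_mul_pow [CharP F 2] {m n : ℕ} (hpow : ∀ x : F, x ^ (2 ^ m) ^ n = x)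
    (x : F) {u : F} (hu : u ^ 2 ^ m = u) :
    powTrace (2 ^ m) n (x ^ 2 ^ m * u + x * u ^ 2 ^ m) = 0 := by
  rw [hu, powTrace_add, ← powTrace_pow (hpow (x * u)), mul_pow, hu, CharTwo.add_self_eq_zero]

lemma powTrace_pow_succ_of_pow_eq_self [CharP F 2] {m n : ℕ} (hn : Odd n) {u : F}
    (hu : u ^ 2 ^ m = u) : powTrace (2 ^ m) n (u ^ (2 ^ m + 1)) = u ^ 2 := by
  rw [pow_succ, hu, ← sq, powTrace_of_pow_eq_self hn]
  rw [← pow_mul, mul_comm, pow_mul, hu]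

/-- For `u ∉ F_q`, every element of `F_q` is of the form `Tr (x ^ q * u + x * u ^ q)`. -/
lemma exists_powTrace_pow_mul_add_mul_pow [CharP F 2] {m n : ℕ} (hn : Odd n)
    (hpow : ∀ x : F, x ^ (2 ^ m) ^ n = x) {u : F} (hu : u ^ 2 ^ m ≠ u) {k : F}
    (hk : k ^ 2 ^ m = k) : ∃ x, powTrace (2 ^ m) n (x ^ 2 ^ m * u + x * u ^ 2 ^ m) = k := by
  set w := u ^ (2 ^ m) ^ (n - 1) with hw
  have hwu : w ^ 2 ^ m = u := by
    rw [hw, ← pow_mul, ← pow_succ, Nat.sub_add_cancel hn.pos, hpow]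
  have hv : w + u ^ 2 ^ m ≠ 0 := fun h => hu <| by
    refine pow_two_pow_eq_self_of_pow_pow hn (hpow u) ?_
    rw [← CharTwo.add_eq_zero.1 h, hwu]
  refine ⟨k / (w + u ^ 2 ^ m), ?_⟩
  set x := k / (w + u ^ 2 ^ m) with hx
  have : (x * w) ^ 2 ^ m = x ^ 2 ^ m * u := by rw [mul_pow, hwu]
  rw [powTrace_add, ← this, powTrace_pow (hpow _), ← powTrace_add, ← mul_add, hx,
    div_mul_cancel₀ _ hv, powTrace_of_pow_eq_self hn hk]

/-- `Tr (x ^ (q + 1)) + L x` is injective if and only if `L u ≠ u ^ 2` for nonzero `u ∈ F_q` and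
`L u ∉ F_q` for `u ∉ F_q`. -/
lemma injective_powTrace_add_iff [CharP F 2] {m n : ℕ} (hn : Odd n)
    (hpow : ∀ x : F, x ^ (2 ^ m) ^ n = x) {L : F → F} (hL : ∀ x y, L (x + y) = L x + L y) :
    Function.Injective (fun x : F => powTrace (2 ^ m) n (x ^ (2 ^ m + 1)) + L x) ↔
      (∀ u : F, u ^ 2 ^ m = u → L u = u ^ 2 → u = 0) ∧
        ∀ u : F, L u ^ 2 ^ m = L u → u ^ 2 ^ m = u := by
  constructor
  · intro h
    have key : ∀ x u : F, powTrace (2 ^ m) n (x ^ 2 ^ m * u + x * u ^ 2 ^ m) =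
        L u + powTrace (2 ^ m) n (u ^ (2 ^ m + 1)) → u = 0 := fun x u hu => by
      have : x + u = x := h <| by
        simp only [powTrace_pow_succ_add, hL, hu]
        linear_combination (L u + powTrace (2 ^ m) n (u ^ (2 ^ m + 1))) *
          (CharTwo.two_eq_zero : (2 : F) = 0)
      simpa using this
    refine ⟨fun u hu hLu => key 0 u ?_, fun u hLu => ?_⟩
    · rw [powTrace_pow_mul_add_mul_pow hpow 0 hu, powTrace_pow_succ_of_pow_eq_self hn hu, hLu,
        CharTwo.add_self_eq_zero]
    · by_contra hu
      obtain ⟨x, hx⟩ := exists_powTrace_pow_mul_add_mul_pow hn hpow hu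
        (k := L u + powTrace (2 ^ m) n (u ^ (2 ^ m + 1)))
        (by rw [add_pow_char_pow, hLu, powTrace_pow_self (hpow _)])
      exact hu (by rw [key x u hx, zero_pow (by positivity)])
  · rintro ⟨h₁, h₂⟩ x y hxy
    obtain ⟨u, rfl⟩ : ∃ u, y = x + u := ⟨x + y, (CharTwo.add_cancel_left x y).symm⟩
    simp only [powTrace_pow_succ_add, hL] at hxy
    have hu : L u = powTrace (2 ^ m) n (x ^ 2 ^ m * u + x * u ^ 2 ^ m) +
        powTrace (2 ^ m) n (u ^ (2 ^ m + 1)) := by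
      linear_combination -hxy - (powTrace (2 ^ m) n (x ^ 2 ^ m * u + x * u ^ 2 ^ m) +
        powTrace (2 ^ m) n (u ^ (2 ^ m + 1))) * (CharTwo.two_eq_zero : (2 : F) = 0)
    have huK : u ^ 2 ^ m = u := h₂ u <| by
      rw [hu, ← powTrace_add, powTrace_pow_self (hpow _)]
    rw [powTrace_pow_mul_add_mul_pow hpow x huK, powTrace_pow_succ_of_pow_eq_self hn huK,
      zero_add] at hu
    rw [h₁ u huK hu, add_zero]

end PowTrace

/-- Let `n` be odd, `q = 2^m`, `F` the field with `q^n` elements, `L` a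
`2`-linear polynomial over `F` such that `Tr(x^(q+1)) + L(x)` is a permutation polynomial of
`F`, and `λ` a `2`-linear polynomial over `F` with adjoint `λ'` such that
`x ↦ x + Tr(λ'(x))` is a bijection of `F_q`.  Then both
`Tr(x^(q+1)) + L(x) + L(Tr(λ(x))) + Tr(λ(x))^2` and
`Tr(x^(q+1)) + L(x) + Tr(λ(L(x))) + Tr(λ(x^2))` are permutation polynomials of `F`. -/
theorem stmt_13 (m n : ℕ) (hm : 0 < m) (hn : Odd n)
    (F : Type*) [Field F] [Fintype F] (hF : Fintype.card F = 2 ^ (m * n))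
    (Lc lc : Fin (m * n) → F)
    (L lam lam' Tr : F → F)
    (hL : ∀ x, L x = ∑ i : Fin (m * n), Lc i * x ^ 2 ^ (i : ℕ))
    (hlam : ∀ x, lam x = ∑ i : Fin (m * n), lc i * x ^ 2 ^ (i : ℕ))
    (hlam' : ∀ x, lam' x = ∑ i : Fin (m * n), (lc i * x) ^ 2 ^ (m * n - (i : ℕ)))
    (hTr : ∀ x, Tr x = ∑ i ∈ Finset.range n, x ^ (2 ^ m) ^ i)
    (hbij : Function.Bijective (fun x : F => Tr (x ^ (2 ^ m + 1)) + L x))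
    (hq : Set.BijOn (fun x : F => x + Tr (lam' x)) {x : F | x ^ 2 ^ m = x}
        {x : F | x ^ 2 ^ m = x}) :
    Function.Bijective
        (fun x : F => Tr (x ^ (2 ^ m + 1)) + L x + L (Tr (lam x)) + (Tr (lam x)) ^ 2) ∧
    Function.Bijective
        (fun x : F => Tr (x ^ (2 ^ m + 1)) + L x + Tr (lam (L x)) + Tr (lam (x ^ 2))) := by
  have : CharP F 2 := charP_of_card_eq_prime_pow hF
  have hpow2 : ∀ x : F, x ^ 2 ^ (m * n) = x := fun x => by rw [← hF, FiniteField.pow_card]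
  have hpow : ∀ x : F, x ^ (2 ^ m) ^ n = x := fun x => by rw [← pow_mul, hpow2]
  have add_of : ∀ {f : F → F} (c : Fin (m * n) → F),
      (∀ x, f x = ∑ i : Fin (m * n), c i * x ^ 2 ^ (i : ℕ)) → ∀ x y, f (x + y) = f x + f y :=
    fun c hf x y => by
      simp only [hf, add_pow_char_pow, mul_add, Finset.sum_add_distrib]
  have hLadd := add_of Lc hL
  have hlamadd := add_of lc hlam
  obtain rfl : Tr = powTrace (2 ^ m) n := funext hTr
  have hker : ∀ w : F, w + powTrace (2 ^ m) n (lam w) = 0 → w = 0 := fun w hw =>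
    eq_zero_of_add_powTrace_eq_zero hn hF
      (fun a b => by rw [hlam, hlam', powTrace_mul_adjoint hpow2]) (fun b hb => hq.surjOn hb) hw
  constructor
  · have hg : Function.Bijective fun x : F => x + powTrace (2 ^ m) n (lam x) := by
      refine Finite.injective_iff_bijective.1 fun x y hxy => ?_
      refine CharTwo.add_eq_zero.1 (hker _ ?_)
      rw [hlamadd, powTrace_add, add_add_add_comm]
      exact CharTwo.add_eq_zero.2 hxy
    convert hbij.comp hg using 1
    funext x
    have ht := powTrace_pow_self (hpow (lam x))
    simp only [Function.comp_apply]
    rw [powTrace_pow_succ_add, powTrace_pow_mul_add_mul_pow hpow x ht,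
      powTrace_pow_succ_of_pow_eq_self hn ht, hLadd]
    ring
  · obtain ⟨h₁, h₂⟩ := (injective_powTrace_add_iff hn hpow hLadd).1 hbij.injective
    refine Finite.injective_iff_bijective.1 ?_
    simp only [add_assoc]
    have hcomb : ∀ u : F, powTrace (2 ^ m) n (lam (L u)) + powTrace (2 ^ m) n (lam (u ^ 2)) =
        powTrace (2 ^ m) n (lam (L u + u ^ 2)) := fun u => by rw [hlamadd, powTrace_add]
    simp only [hcomb]
    refine (injective_powTrace_add_iff hn hpow
      (L := fun x => L x + powTrace (2 ^ m) n (lam (L x + x ^ 2))) fun x y => ?_).2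
      ⟨fun u hu hLu => h₁ u hu (CharTwo.add_eq_zero.1 (hker _ ?_)), fun u hLu => h₂ u ?_⟩
    · simp only [hLadd, CharTwo.add_sq, add_add_add_comm (L x), hlamadd, powTrace_add]
      ring
    · rw [add_right_comm]
      exact CharTwo.add_eq_zero.2 hLu
    · simpa only [add_pow_char_pow, powTrace_pow_self (hpow _), add_left_inj] using hLu
end

section
/- Let n be even, L a 2-linear polynomial over F_{q^n}, and A ∈ F_{q^n}^* with A^{(q^n-1)/(q+1)} ≠ 1. Then Tr(A·x^{q+1}) + L(x) is not a permutation polynomial of F_{q^n}. -/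
open Finset Polynomial in
/-- The power sum `∑ i < n, x ^ (q ^ i)` defining the trace does not vanish identically on a
field with `q ^ n` elements. -/
theorem exists_sum_pow_pow_ne_zero_s15 {F : Type*} [Field F] [Fintype F] {q n : ℕ} (hq : 1 < q)
    (hn : 0 < n) (hF : Fintype.card F = q ^ n) :
    ∃ x : F, ∑ i ∈ range n, x ^ q ^ i ≠ 0 := by
  by_contra! h
  have hzero : (∑ i ∈ range n, (X : F[X]) ^ q ^ i) = 0 := by
    refine eq_zero_of_natDegree_lt_card_of_eval_eq_zero _ (f := (id : F → F))
      Function.injective_id (fun x => by simpa [eval_finsetSum] using h x) ?_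
    rw [hF]
    refine lt_of_le_of_lt (natDegree_sum_le_of_forall_le (n := q ^ (n - 1)) _ _ fun i hi => ?_)
      (Nat.pow_lt_pow_right hq (by omega))
    rw [natDegree_X_pow]
    exact Nat.pow_le_pow_right (by omega) (by have := mem_range.1 hi; omega)
  have hcoeff := congrArg (fun p : F[X] => p.coeff 1) hzero
  simp only [finsetSum_coeff, coeff_X_pow, coeff_zero] at hcoeff
  rw [sum_eq_single_of_mem 0 (mem_range.2 hn)] at hcoeff
  · simp at hcoeff
  · intro i _ hi
    exact if_neg (Nat.one_lt_pow hi hq).ne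

open Finset in
theorem sum_pow_pow_shift {F : Type*} [Field F] [Fintype F] {q n : ℕ}
    (hF : Fintype.card F = q ^ n) (x : F) :
    ∑ i ∈ range n, (x ^ q) ^ q ^ i = ∑ i ∈ range n, x ^ q ^ i := by
  have h := (sum_range_succ' (fun i => x ^ q ^ i) n).symm.trans
    (sum_range_succ (fun i => x ^ q ^ i) n)
  simp only [← hF, FiniteField.pow_card, pow_zero, pow_one] at h
  rw [← add_right_cancel h]
  exact sum_congr rfl fun i _ => by rw [← pow_mul, pow_succ']

/-- The adjoint `u ↦ A * u + (A * u ^ q) ^ q` of the polar form of `Tr (A * x ^ (q + 1))` has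
trivial kernel when `A` is not a `(q + 1)`-st power. -/
theorem frobenius_mul_add_ne_zero {F : Type*} [Field F] [Fintype F] [CharP F 2] {q n : ℕ}
    (hq : 1 < q) (hn : Even n) (hF : Fintype.card F = q ^ n) {A u : F} (hA : A ≠ 0) (hu : u ≠ 0)
    (hA' : A ^ ((q ^ n - 1) / (q + 1)) ≠ 1) :
    A * u + (A * u ^ q) ^ q ≠ 0 := by
  intro h
  rw [CharTwo.add_eq_zero] at h
  have hpow : (A * u ^ (q + 1)) ^ (q - 1) = 1 := by
    refine mul_left_cancel₀ (mul_ne_zero hA (pow_ne_zero (q + 1) hu)) ?_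
    rw [mul_pow_sub_one (by omega), mul_one]
    calc (A * u ^ (q + 1)) ^ q = (A * u ^ q) ^ q * u ^ q := by ring
      _ = A * u ^ (q + 1) := by rw [← h]; ring
  obtain ⟨k, rfl⟩ := hn
  have hdvd : (q + 1) * (q - 1) ∣ q ^ (k + k) - 1 := by
    have := Nat.sub_dvd_pow_sub_pow (q ^ 2) (1 ^ 2) k
    rwa [Nat.sq_sub_sq, ← pow_mul, one_pow, one_pow, two_mul] at this
  obtain ⟨j, hj⟩ := hdvd
  have hs : (q ^ (k + k) - 1) / (q + 1) = (q - 1) * j := by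
    rw [hj, mul_assoc, Nat.mul_div_cancel_left _ (by omega)]
  have hone : (A * u ^ (q + 1)) ^ ((q - 1) * j) = 1 := by rw [pow_mul, hpow, one_pow]
  rw [mul_pow, ← pow_mul, ← mul_assoc, ← hj, ← hF, FiniteField.pow_card_sub_one_eq_one u hu,
    mul_one] at hone
  exact hA' (hs ▸ hone)

/-- Let `n` be even, `q = 2^m`, `F` the field with `q^n` elements, `L` a
`2`-linear polynomial over `F`, and `A ∈ F^*` with `A^((q^n-1)/(q+1)) ≠ 1`.  Then
`Tr(A·x^(q+1)) + L(x)` is not a permutation polynomial of `F`. -/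
theorem stmt_15 (m n : ℕ) (hm : 0 < m) (hn : Even n) (hn0 : 0 < n)
    (F : Type*) [Field F] [Fintype F] (hF : Fintype.card F = 2 ^ (m * n))
    (a : Fin (m * n) → F)
    (L Tr : F → F)
    (hL : ∀ x, L x = ∑ i : Fin (m * n), a i * x ^ 2 ^ (i : ℕ))
    (hTr : ∀ x, Tr x = ∑ i ∈ Finset.range n, x ^ (2 ^ m) ^ i)
    (A : F) (hA : A ≠ 0)
    (hA' : A ^ ((2 ^ (m * n) - 1) / (2 ^ m + 1)) ≠ 1) :
    ¬ Function.Bijective (fun x : F => Tr (A * x ^ (2 ^ m + 1)) + L x) := by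
  intro hbij
  obtain ⟨q, hqdef⟩ : ∃ q, q = 2 ^ m := ⟨_, rfl⟩
  have : CharP F 2 := by
    have : Fact (Nat.Prime 2) := ⟨Nat.prime_two⟩
    exact charP_of_card_eq_prime_pow hF
  have hq : 1 < q := hqdef ▸ Nat.one_lt_two_pow hm.ne'
  have hFq : Fintype.card F = q ^ n := by rw [hF, hqdef, pow_mul]
  have hadd (x y : F) (k : ℕ) : (x + y) ^ 2 ^ k = x ^ 2 ^ k + y ^ 2 ^ k :=
    add_pow_char_pow x y 2 k
  have haddq (x y : F) : (x + y) ^ q = x ^ q + y ^ q := hqdef ▸ hadd x y m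
  have hLadd (x y : F) : L (x + y) = L x + L y := by
    simp only [hL, hadd, mul_add, Finset.sum_add_distrib]
  rw [pow_mul, ← hqdef] at hA'
  simp only [← hqdef] at hTr hbij
  have hTradd (x y : F) : Tr (x + y) = Tr x + Tr y := by
    simp only [hTr, hqdef, ← pow_mul, hadd, Finset.sum_add_distrib]
  have hTrFrob (x : F) : Tr (x ^ q) = Tr x := by
    simp only [hTr, sum_pow_pow_shift hFq]
  have hTrpow (x : F) : Tr x ^ q = Tr x := by
    refine Eq.trans ?_ (hTrFrob x)
    rw [hTr, hTr, hqdef, sum_pow_char_pow]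
    exact Finset.sum_congr rfl fun i _ => pow_right_comm x _ _
  have hTrsmul (c x : F) (hc : c ^ q = c) : Tr (c * x) = c * Tr x := by
    have hci (i : ℕ) : c ^ q ^ i = c := by
      induction i with
      | zero => simp
      | succ i ih => rw [pow_succ, pow_mul, ih, hc]
    simp only [hTr, mul_pow, hci, Finset.mul_sum]
  have hFrobSurj : Function.Surjective (fun x : F => x ^ q) := by
    refine Finite.surjective_of_injective fun x y hxy => ?_
    have hsub : (x + y) ^ q = 0 := by
      rw [haddq]
      exact CharTwo.add_eq_zero.2 hxy
    exact CharTwo.add_eq_zero.1 (eq_zero_of_pow_eq_zero hsub)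
  have hpolar (u x : F) : Tr (A * (x + u) ^ (q + 1)) =
      Tr (A * x ^ (q + 1)) + Tr (A * u ^ (q + 1)) + Tr (x ^ q * (A * u + (A * u ^ q) ^ q)) := by
    have hx : Tr (x ^ q * (A * u + (A * u ^ q) ^ q)) =
        Tr (x ^ q * (A * u)) + Tr (x * (A * u ^ q)) := by
      rw [mul_add, hTradd, ← mul_pow, hTrFrob]
    rw [hx, ← hTradd, ← hTradd, ← hTradd, pow_succ, haddq]
    ring_nf
  have hLnot (u : F) (hu : u ≠ 0) : L u ^ q ≠ L u := by
    intro hLu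
    have hw := frobenius_mul_add_ne_zero hq hn hFq hA hu hA'
    obtain ⟨w, hwdef⟩ : ∃ w, w = A * u + (A * u ^ q) ^ q := ⟨_, rfl⟩
    rw [← hwdef] at hw
    obtain ⟨z, hz⟩ := exists_sum_pow_pow_ne_zero_s15 hq hn0 hFq
    rw [← hTr] at hz
    have hc : ((Tr (A * u ^ (q + 1)) + L u) / Tr z) ^ q =
        (Tr (A * u ^ (q + 1)) + L u) / Tr z := by
      rw [div_pow, haddq, hTrpow, hTrpow, hLu]
    obtain ⟨x, hx⟩ := hFrobSurj ((Tr (A * u ^ (q + 1)) + L u) / Tr z * z / w)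
    have hcollision : Tr (A * (x + u) ^ (q + 1)) + L (x + u) =
        Tr (A * x ^ (q + 1)) + L x := by
      have hval : Tr (x ^ q * w) = Tr (A * u ^ (q + 1)) + L u := by
        have hxw : x ^ q * w = (Tr (A * u ^ (q + 1)) + L u) / Tr z * z := by
          rw [show x ^ q = _ from hx, div_mul_cancel₀ _ hw]
        rw [hxw, hTrsmul _ _ hc, div_mul_cancel₀ _ hz]
      rw [hpolar, ← hwdef, hval, hLadd]
      linear_combination (Tr (A * u ^ (q + 1)) + L u) * CharTwo.two_eq_zero (R := F)
    exact hu (by simpa using hbij.injective hcollision)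
  have hLsurj : Function.Surjective L := by
    refine Finite.surjective_of_injective fun x y hxy => ?_
    by_contra hne
    refine hLnot (x + y) (fun h => hne (CharTwo.add_eq_zero.1 h)) ?_
    rw [hLadd, CharTwo.add_eq_zero.2 hxy, zero_pow (by omega)]
  obtain ⟨u, hu⟩ := hLsurj 1
  refine hLnot u (fun h0 => ?_) (by rw [hu, one_pow])
  have hL0 := hLadd 0 0
  rw [add_zero, ← h0, hu] at hL0
  simp at hL0
end

section
/- Let n be even, L(x) = L_k(x^{2^k}) + L_l(x^{2^l}) where L_k and L_l are q^2-linear polynomials over F_{q^n}, and k, l integers with 0 ≤ k < l < 2m. Set e = gcd(l-k, 2m), a = L_k(1), b = L_l(1), and δ = a^{q^2}·b + a·b^{q^2}. Then ker(Tr_2 ∘ L') ⊆ ker Tr if and only if one of the following holds: (1) l - k = m, a ∉ F_{q^2}, δ ≠ 0, and δ^q·(a^{q^2}+a) + δ·(b^{q^3}+b^q) = 0 and δ^q·(b^{q^2}+b) + δ·(a^{q^3}+a^q) = 0; (2) a, b ∈ F_{q^2} and a^{(q^2-1)/(2^e-1)} ≠ b^{(q^2-1)/(2^e-1)}; (3)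 e divides m, a, b ∈ F_{q^2}^*, and a^{2^{l-k}·(q-1)/(2^e-1)} = b^{(q-1)/(2^e-1)}. -/
section CyclicGroup

variable {G : Type*} [CommGroup G]

/-- In a finite cyclic group, an element killed by `M` is a `D`-th power of an element killed by
`D * M`, provided that `D * M` divides the order. -/
theorem exists_pow_eq_of_pow_eq_one [Finite G] [IsCyclic G] {D M : ℕ} (hdvd : D * M ∣ Nat.card G)
    {g : G} (hg : g ^ M = 1) : ∃ y : G, y ^ (D * M) = 1 ∧ y ^ D = g := by
  obtain ⟨γ, hγ⟩ := IsCyclic.exists_generator (α := G)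
  have hord : orderOf γ = Nat.card G := orderOf_eq_card_of_forall_mem_zpowers hγ
  obtain ⟨i, rfl⟩ := mem_powers_iff_mem_zpowers.mpr (hγ g)
  simp only at hg ⊢
  obtain ⟨c, hc⟩ := hdvd
  have hpos : 0 < D * M * c := hc ▸ Nat.card_pos
  have hM : 0 < M := Nat.pos_of_ne_zero (by rintro rfl; simp at hpos)
  rw [← pow_mul] at hg
  have h1 : D * M * c ∣ i * M := by
    rw [← hc, ← hord]; exact orderOf_dvd_of_pow_eq_one hg
  have h2 : D * c ∣ i := by
    refine Nat.dvd_of_mul_dvd_mul_right hM ?_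
    convert h1 using 1; ring
  obtain ⟨j, rfl⟩ := h2
  refine ⟨γ ^ (c * j), ?_, ?_⟩
  · rw [← pow_mul, show c * j * (D * M) = D * M * c * j by ring, pow_mul, ← hc, ← hord,
      pow_orderOf_eq_one, one_pow]
  · rw [← pow_mul]; ring_nf

theorem exists_pow_eq_pow_gcd {y : G} {N : ℕ} (hy : y ^ N = 1) (S : ℕ) :
    ∃ i : ℤ, (y ^ i) ^ S = y ^ Nat.gcd S N := by
  refine ⟨Nat.gcdA S N, ?_⟩
  rw [← zpow_natCast y (Nat.gcd S N), Nat.gcd_eq_gcd_ab, zpow_add, zpow_mul y (N : ℤ),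
    zpow_natCast y N, hy, one_zpow, mul_one, ← zpow_natCast, ← zpow_mul, mul_comm]

/-- In a cyclic group of order `2^(2m) - 1`, all solutions of `w^(2^d - 1) = g` lie in the subgroup
of order `2^m - 1` iff there are none or `g` is a `(2^d - 1)`-th power within that subgroup. -/
theorem forall_pow_eq_imp_pow_eq_one_iff [Finite G] [IsCyclic G] {m d e : ℕ} (hm : 0 < m)
    (hG : Nat.card G = 2 ^ (2 * m) - 1) (he : e = Nat.gcd d (2 * m)) (g : G) :
    (∀ w : G, w ^ (2 ^ d - 1) = g → w ^ (2 ^ m - 1) = 1) ↔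
      g ^ ((2 ^ (2 * m) - 1) / (2 ^ e - 1)) ≠ 1 ∨
        (e ∣ m ∧ g ^ ((2 ^ m - 1) / (2 ^ e - 1)) = 1) := by
  have hgcd : Nat.gcd (2 ^ d - 1) (2 ^ (2 * m) - 1) = 2 ^ e - 1 := by
    rw [Nat.pow_sub_one_gcd_pow_sub_one, he]
  obtain ⟨S', hS'⟩ : 2 ^ e - 1 ∣ 2 ^ d - 1 := hgcd ▸ Nat.gcd_dvd_left _ _
  have hDN : 2 ^ e - 1 ∣ 2 ^ (2 * m) - 1 := hgcd ▸ Nat.gcd_dvd_right _ _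
  have hepos : 0 < e := he ▸ Nat.gcd_pos_of_pos_right _ (by omega)
  have hD : 0 < 2 ^ e - 1 := Nat.sub_pos_of_lt (Nat.one_lt_two_pow hepos.ne')
  have hmN : 2 ^ m - 1 ∣ 2 ^ (2 * m) - 1 := Nat.pow_sub_one_dvd_pow_sub_one _ ⟨2, by ring⟩
  have hpow : ∀ w : G, w ^ (2 ^ (2 * m) - 1) = 1 := fun w ↦ hG ▸ pow_card_eq_one'
  have hsol : ∀ {y : G} {r : ℕ}, y ^ r = 1 → y ^ (2 ^ e - 1) = g →
      ∃ w : G, w ^ r = 1 ∧ w ^ (2 ^ d - 1) = g := by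
    intro y r hy hyg
    obtain ⟨i, hi⟩ := exists_pow_eq_pow_gcd (hpow y) (2 ^ d - 1)
    refine ⟨y ^ i, ?_, by rw [hi, hgcd, hyg]⟩
    rw [← zpow_natCast, ← zpow_mul, mul_comm, zpow_mul, zpow_natCast, hy, one_zpow]
  have hroot : ∀ z : G, z ^ (2 ^ e - 1) = 1 → z ^ (2 ^ d - 1) = 1 := fun z hz ↦ by
    rw [hS', pow_mul, hz, one_pow]
  constructor
  · intro h
    by_cases hg : g ^ ((2 ^ (2 * m) - 1) / (2 ^ e - 1)) = 1
    · right
      obtain ⟨y, -, hyg⟩ := exists_pow_eq_of_pow_eq_one (D := 2 ^ e - 1)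
        (by rw [Nat.mul_div_cancel' hDN, hG]) hg
      obtain ⟨w, -, hw⟩ := hsol (hpow y) hyg
      obtain ⟨γ, hγ⟩ := IsCyclic.exists_ofOrder_eq_natCard (α := G)
      obtain ⟨z, hz⟩ : ∃ z : G, orderOf z = 2 ^ e - 1 := by
        obtain ⟨c, hc⟩ := hDN
        have hc0 : c ≠ 0 := by
          rintro rfl
          have : 0 < Nat.card G := Nat.card_pos
          omega
        refine ⟨γ ^ c, ?_⟩
        rw [orderOf_pow_of_dvd hc0 (by rw [hγ, hG, hc]; exact dvd_mul_left _ _), hγ, hG, hc,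
          Nat.mul_div_cancel _ (Nat.pos_of_ne_zero hc0)]
      have hz1 : z ^ (2 ^ e - 1) = 1 := hz ▸ pow_orderOf_eq_one z
      have hw1 := h w hw
      have hwz := h (w * z) (by rw [mul_pow, hw, hroot z hz1, mul_one])
      rw [mul_pow, hw1, one_mul] at hwz
      have hdm : 2 ^ e - 1 ∣ 2 ^ m - 1 := hz ▸ orderOf_dvd_of_pow_eq_one hwz
      refine ⟨?_, ?_⟩
      · have h1 := Nat.gcd_eq_left hdm
        rw [Nat.pow_sub_one_gcd_pow_sub_one] at h1
        have h2 : 2 ^ Nat.gcd e m = 2 ^ e := by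
          have := Nat.one_le_two_pow (n := Nat.gcd e m)
          have := Nat.one_le_two_pow (n := e)
          omega
        exact Nat.gcd_eq_left_iff_dvd.mp (Nat.pow_right_injective le_rfl h2)
      · obtain ⟨c, hc⟩ := hdm
        rw [← hw, ← pow_mul, hS', hc, Nat.mul_div_cancel_left _ hD,
          show (2 ^ e - 1) * S' * c = (2 ^ e - 1) * c * S' by ring, ← hc, pow_mul, hw1, one_pow]
    · exact Or.inl hg
  · rintro (hg | ⟨hem, hg⟩) w hw
    · refine absurd ?_ hg
      rw [← hw, ← pow_mul, hS', mul_assoc, mul_left_comm, Nat.mul_div_cancel' hDN, mul_comm,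
        pow_mul, hpow, one_pow]
    · have hDm : 2 ^ e - 1 ∣ 2 ^ m - 1 := Nat.pow_sub_one_dvd_pow_sub_one _ hem
      obtain ⟨y, hy, hyg⟩ := exists_pow_eq_of_pow_eq_one (D := 2 ^ e - 1)
        (by rw [Nat.mul_div_cancel' hDm, hG]; exact hmN) hg
      rw [Nat.mul_div_cancel' hDm] at hy
      obtain ⟨w₀, hw₀, hw₀g⟩ := hsol hy hyg
      have h1 : (w / w₀) ^ (2 ^ d - 1) = 1 := by rw [div_pow, hw, hw₀g, div_self']
      have h2 : (w / w₀) ^ (2 ^ e - 1) = 1 := by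
        rw [← hgcd]; exact pow_gcd_eq_one.mpr ⟨h1, hpow _⟩
      obtain ⟨c, hc⟩ := hDm
      have h3 : (w / w₀) ^ (2 ^ m - 1) = 1 := by rw [hc, pow_mul, h2, one_pow]
      rwa [div_pow, hw₀, div_one] at h3

end CyclicGroup

section FiniteField

variable {K : Type*} [Field K] [Fintype K]

theorem pow_eq_mul_pow_sub_one {M : Type*} [Monoid M] (x : M) {r : ℕ} (hr : 0 < r) :
    x ^ r = x ^ (r - 1) * x := by rw [← pow_succ, Nat.sub_add_cancel hr]

/-- The case in which both coefficients lie in the field `K` with `2^(2m)` elements. -/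
theorem forall_mul_pow_eq_mul_imp_iff {m d e : ℕ} (hm : 0 < m)
    (hK : Fintype.card K = 2 ^ (2 * m)) (he : e = Nat.gcd d (2 * m)) (a b : K) :
    (∀ w : K, (a * w) ^ 2 ^ d = b * w → w ^ 2 ^ m = w) ↔
      a ^ ((2 ^ (2 * m) - 1) / (2 ^ e - 1)) ≠ b ^ ((2 ^ (2 * m) - 1) / (2 ^ e - 1)) ∨
        (e ∣ m ∧ a ≠ 0 ∧ b ≠ 0 ∧
          a ^ (2 ^ d * (2 ^ m - 1) / (2 ^ e - 1)) = b ^ ((2 ^ m - 1) / (2 ^ e - 1))) := by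
  classical
  have hgcd : Nat.gcd (2 ^ d - 1) (2 ^ (2 * m) - 1) = 2 ^ e - 1 := by
    rw [Nat.pow_sub_one_gcd_pow_sub_one, he]
  obtain ⟨S', hS'⟩ : 2 ^ e - 1 ∣ 2 ^ d - 1 := hgcd ▸ Nat.gcd_dvd_left _ _
  have hDN : 2 ^ e - 1 ∣ 2 ^ (2 * m) - 1 := hgcd ▸ Nat.gcd_dvd_right _ _
  have hN0 : (2 ^ (2 * m) - 1) / (2 ^ e - 1) ≠ 0 := by
    have h1 : 0 < 2 ^ (2 * m) - 1 :=
      Nat.sub_pos_of_lt (Nat.one_lt_two_pow (by omega))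
    exact (Nat.div_pos (Nat.le_of_dvd h1 hDN) (Nat.pos_of_dvd_of_pos hDN h1)).ne'
  by_cases ha : a = 0
  · subst ha
    by_cases hb : b = 0
    · subst hb
      simp only [zero_mul, ne_eq, not_true_eq_false, false_and, and_false, or_false, iff_false,
        not_forall]
      obtain ⟨γ, hγ⟩ := IsCyclic.exists_ofOrder_eq_natCard (α := Kˣ)
      refine ⟨γ, by simp, fun h ↦ ?_⟩
      rw [pow_eq_mul_pow_sub_one _ (by positivity), mul_eq_right₀ γ.ne_zero] at h
      have h1 : orderOf γ ∣ 2 ^ m - 1 := orderOf_dvd_of_pow_eq_one (by ext; simpa using h)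
      rw [hγ, Nat.card_eq_fintype_card, Fintype.card_units, hK] at h1
      have h2 := Nat.le_of_dvd (Nat.sub_pos_of_lt (Nat.one_lt_two_pow hm.ne')) h1
      have h3 : 2 ^ m < 2 ^ (2 * m) := Nat.pow_lt_pow_right (by norm_num) (by omega)
      have := Nat.one_le_two_pow (n := m)
      omega
    · refine iff_of_true (fun w hw ↦ ?_) (Or.inl ?_)
      · rw [zero_mul, zero_pow (by positivity), eq_comm, mul_eq_zero, or_iff_right hb] at hw
        rw [hw, zero_pow (by positivity)]
      · rw [zero_pow hN0]; exact (pow_ne_zero _ hb).symm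
  by_cases hb : b = 0
  · subst hb
    refine iff_of_true (fun w hw ↦ ?_) (Or.inl ?_)
    · rw [zero_mul, pow_eq_zero_iff (by positivity), mul_eq_zero, or_iff_right ha] at hw
      rw [hw, zero_pow (by positivity)]
    · rw [zero_pow hN0]; exact pow_ne_zero _ ha
  lift a to Kˣ using Ne.isUnit ha with u
  lift b to Kˣ using Ne.isUnit hb with v
  have hcard : Nat.card Kˣ = 2 ^ (2 * m) - 1 := by
    rw [Nat.card_eq_fintype_card, Fintype.card_units, hK]
  have key := forall_pow_eq_imp_pow_eq_one_iff hm hcard he (v / u ^ 2 ^ d)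
  have hu : (u ^ 2 ^ d) ^ ((2 ^ (2 * m) - 1) / (2 ^ e - 1)) =
      u ^ ((2 ^ (2 * m) - 1) / (2 ^ e - 1)) := by
    rw [pow_eq_mul_pow_sub_one u (by positivity : 0 < 2 ^ d), mul_pow, ← pow_mul, hS', mul_assoc,
      mul_left_comm, Nat.mul_div_cancel' hDN, mul_comm S', pow_mul, ← hcard, pow_card_eq_one',
      one_pow, one_mul]
  rw [div_pow, hu, div_pow, ← pow_mul, ne_eq, div_eq_one, div_eq_one] at key
  have hl : (∀ w : K, (u * w) ^ 2 ^ d = v * w → w ^ 2 ^ m = w) ↔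
      ∀ w : Kˣ, w ^ (2 ^ d - 1) = v / u ^ 2 ^ d → w ^ (2 ^ m - 1) = 1 := by
    have h1 : ∀ w : Kˣ, ((u * w : K) ^ 2 ^ d = v * w ↔ w ^ (2 ^ d - 1) = v / u ^ 2 ^ d) := by
      intro w
      rw [eq_div_iff_mul_eq', ← mul_left_inj w, mul_right_comm,
        ← pow_eq_mul_pow_sub_one w (by positivity), ← mul_pow, mul_comm w u]
      norm_cast
    have h2 : ∀ w : Kˣ, ((w : K) ^ 2 ^ m = w ↔ w ^ (2 ^ m - 1) = 1) := by
      intro w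
      rw [← mul_eq_right (b := w), ← pow_eq_mul_pow_sub_one w (by positivity)]
      norm_cast
    refine ⟨fun h w hw ↦ (h2 w).1 (h w ((h1 w).2 hw)), fun h w hw ↦ ?_⟩
    by_cases hw0 : w = 0
    · rw [hw0, zero_pow (by positivity)]
    lift w to Kˣ using Ne.isUnit hw0
    exact (h2 w).2 (h w ((h1 w).1 hw))
  rw [hl, key]
  refine or_congr ?_ (and_congr_right fun hem ↦ ?_)
  · rw [not_iff_not, eq_comm]; norm_cast
  · have hDm : 2 ^ e - 1 ∣ 2 ^ m - 1 := Nat.pow_sub_one_dvd_pow_sub_one _ hem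
    rw [Nat.mul_div_assoc _ hDm, eq_comm]
    simp only [ne_eq, Units.ne_zero, not_false_eq_true, true_and]
    norm_cast

/-- The powers `u ^ 2 ^ i`, `i < r`, are linearly independent functions on a field with `2 ^ r`
elements. -/
theorem eq_zero_of_forall_sum_mul_pow_two_pow_eq_zero {r : ℕ} (hK : Fintype.card K = 2 ^ r)
    (f : ℕ → K) (hf : ∀ u : K, ∑ i ∈ Finset.range r, f i * u ^ 2 ^ i = 0) {i : ℕ} (hi : i < r) :
    f i = 0 := by
  open Polynomial in
  let P : K[X] := ∑ i ∈ Finset.range r, C (f i) * X ^ 2 ^ i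
  have hP : P = 0 := by
    refine eq_zero_of_natDegree_lt_card_of_eval_eq_zero P Function.injective_id (fun u ↦ ?_) ?_
    · simpa [P, eval_finsetSum] using hf u
    · rw [hK]
      refine (natDegree_sum_le_of_forall_le (n := 2 ^ r - 1) _ _ fun j hj ↦ ?_).trans_lt
        (Nat.sub_lt (by positivity) one_pos)
      refine (natDegree_C_mul_X_pow_le _ _).trans (Nat.le_sub_one_of_lt ?_)
      exact Nat.pow_lt_pow_right (by norm_num) (Finset.mem_range.mp hj)
  have hc : P.coeff (2 ^ i) = f i := by
    simp only [P, finsetSum_coeff, coeff_C_mul, coeff_X_pow]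
    rw [Finset.sum_eq_single i]
    · simp
    · intro j _ hj
      simp [(Nat.pow_right_injective le_rfl).ne hj.symm]
    · simp [hi]
  rw [← hc, hP, coeff_zero]

/-- The case in which `a ∉ K` and `b` is an affine combination of `1` and `a`. -/
theorem forall_div_pow_eq_div_iff {m d : ℕ} (hd : 0 < d) (hd2 : d < 2 * m) [CharP K 2]
    (hK : Fintype.card K = 2 ^ (2 * m)) {c : K} (hc : c ≠ 0) (t : K) :
    (∀ u : K, ((u ^ 2 ^ d + t * u) / c) ^ 2 ^ m = (u ^ 2 ^ d + t * u) / c) ↔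
      d = m ∧ c ^ 2 ^ m * t = c ∧ t ^ 2 ^ m * t = 1 := by
  have hcm : c ^ 2 ^ m ≠ 0 := pow_ne_zero _ hc
  have hKu (u : K) : u ^ 2 ^ (2 * m) = u := hK ▸ FiniteField.pow_card u
  constructor
  · intro h
    obtain ⟨d', hd', hdm, hd'm⟩ : ∃ d' < 2 * m, (∀ u : K, u ^ 2 ^ (d + m) = u ^ 2 ^ d') ∧
        (d' + m = d ∨ d' = d + m) := by
      rcases lt_or_ge d m with hlt | hge
      · exact ⟨d + m, by omega, fun _ ↦ rfl, Or.inr rfl⟩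
      · refine ⟨d - m, by omega, fun u ↦ ?_, Or.inl (by omega)⟩
        rw [show d + m = 2 * m + (d - m) by omega, pow_add, pow_mul, hKu]
    let f : ℕ → K := fun i ↦ (if i = d' then c else 0) + (if i = m then c * t ^ 2 ^ m else 0) +
      (if i = d then c ^ 2 ^ m else 0) + if i = 0 then t * c ^ 2 ^ m else 0
    have hf : ∀ u : K, ∑ i ∈ Finset.range (2 * m), f i * u ^ 2 ^ i = 0 := by
      intro u
      have h1 := h u
      rw [div_pow, div_eq_div_iff hcm hc, add_pow_char_pow, mul_pow, ← pow_mul, ← pow_add, hdm,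
        ← CharTwo.add_eq_zero] at h1
      rw [← h1]
      simp only [f, add_mul, ite_mul, zero_mul, Finset.sum_add_distrib, Finset.sum_ite_eq',
        Finset.mem_range, hd', hd2, show m < 2 * m by omega, show 0 < 2 * m by omega, if_true]
      ring
    have hfi {i : ℕ} (hi : i < 2 * m) : f i = 0 :=
      eq_zero_of_forall_sum_mul_pow_two_pow_eq_zero hK f hf hi
    have hfd := hfi hd2
    have hf0 := hfi (i := 0) (by omega)
    obtain rfl : d = m := by
      by_contra hne
      simp [f, hd.ne', hne, show d ≠ d' by omega] at hfd
      exact hc hfd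
    obtain rfl : d' = 0 := by omega
    simp only [f, hd.ne', hd.ne, if_true, if_false, add_zero, zero_add] at hfd hf0
    rw [CharTwo.add_eq_zero] at hfd hf0
    refine ⟨rfl, by rw [mul_comm, ← hf0], mul_left_cancel₀ hcm ?_⟩
    linear_combination hfd - t ^ 2 ^ d * hf0
  · rintro ⟨rfl, hct, ht⟩ u
    rw [div_pow, div_eq_div_iff hcm hc, add_pow_char_pow, mul_pow, ← pow_mul, ← pow_add,
      ← two_mul, hKu]
    linear_combination (-u - t ^ 2 ^ d * u ^ 2 ^ d) * hct + u ^ 2 ^ d * c ^ 2 ^ d * ht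

/-- The elements of a subfield `K` of a finite field are the roots of `X ^ #K - X`. -/
theorem mem_range_algebraMap_iff_pow_card_eq {F : Type*} [Field F] [Finite F] [Algebra K F]
    {x : F} : x ∈ Set.range (algebraMap K F) ↔ x ^ Fintype.card K = x := by
  constructor
  · rintro ⟨y, rfl⟩
    rw [← map_pow, FiniteField.pow_card]
  · intro h
    rw [IsGalois.mem_range_algebraMap_iff_fixed]
    intro f
    obtain ⟨i, rfl⟩ := (FiniteField.bijective_frobeniusAlgEquivOfAlgebraic_pow K F).2 f
    rw [AlgEquiv.coe_pow]
    exact Function.iterate_fixed (by simpa using h) _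

end FiniteField

section Trace

variable {K F : Type*} [Field K] [Field F] [Algebra K F]

theorem exists_trace_mul_eq_of_linearIndependent [FiniteDimensional K F] [Algebra.IsSeparable K F]
    {ι : Type*} [Fintype ι] {v : ι → F} (hv : LinearIndependent K v) (y : ι → K) :
    ∃ x : F, ∀ i, Algebra.trace K F (v i * x) = y i := by
  classical
  let Φ : F →ₗ[K] (ι → K) := LinearMap.pi fun i ↦ Algebra.traceForm K F (v i)
  suffices h : LinearMap.range Φ = ⊤ by
    obtain ⟨x, hx⟩ := LinearMap.range_eq_top.mp h y
    exact ⟨x, fun i ↦ congrFun hx i⟩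
  by_contra h
  obtain ⟨f, hf0, hf⟩ := Submodule.exists_le_ker_of_lt_top _ (lt_top_iff_ne_top.mpr h)
  have hsum : ∑ i, f (Pi.single i 1) • v i = 0 := by
    refine (traceForm_nondegenerate K F).1 _ fun x ↦ ?_
    have hx : f (Φ x) = 0 := hf ⟨x, rfl⟩
    rw [pi_eq_sum_univ' (Φ x)] at hx
    simpa [Φ, mul_comm] using hx
  have hc := Fintype.linearIndependent_iff.mp hv _ hsum
  exact hf0 (LinearMap.pi_ext' fun i ↦ LinearMap.ext_ring (by simpa using hc i))

theorem trace_pow_two_pow_s17 [Finite F] [CharP F 2] [CharP K 2] (x : F) (i : ℕ) :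
    Algebra.trace K F (x ^ 2 ^ i) = Algebra.trace K F x ^ 2 ^ i := by
  apply FaithfulSMul.algebraMap_injective K F
  rw [map_pow (algebraMap K F), FiniteField.algebraMap_trace_eq_sum_pow,
    FiniteField.algebraMap_trace_eq_sum_pow,
    sum_pow_char_pow]
  exact Finset.sum_congr rfl fun j _ ↦ pow_right_comm _ _ _

variable [Fintype K] [Finite F]

theorem forall_trace_pow_eq_imp_iff {m d e : ℕ} (hm : 0 < m) (hd : 0 < d) (hd2 : d < 2 * m)
    [CharP K 2] [CharP F 2] (hK : Fintype.card K = 2 ^ (2 * m)) (he : e = Nat.gcd d (2 * m))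
    (a b δ : F) (hδ : δ = a ^ (2 ^ m) ^ 2 * b + a * b ^ (2 ^ m) ^ 2) :
    (∀ x : F, Algebra.trace K F (a * x) ^ 2 ^ d = Algebra.trace K F (b * x) →
        Algebra.trace K F x ^ 2 ^ m = Algebra.trace K F x) ↔
      ((d = m ∧ a ^ (2 ^ m) ^ 2 ≠ a ∧ δ ≠ 0 ∧
          δ ^ 2 ^ m * (a ^ (2 ^ m) ^ 2 + a) + δ * (b ^ (2 ^ m) ^ 3 + b ^ 2 ^ m) = 0 ∧
          δ ^ 2 ^ m * (b ^ (2 ^ m) ^ 2 + b) + δ * (a ^ (2 ^ m) ^ 3 + a ^ 2 ^ m) = 0) ∨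
       (a ^ (2 ^ m) ^ 2 = a ∧ b ^ (2 ^ m) ^ 2 = b ∧
          a ^ ((2 ^ (2 * m) - 1) / (2 ^ e - 1)) ≠ b ^ ((2 ^ (2 * m) - 1) / (2 ^ e - 1))) ∨
       (e ∣ m ∧ a ≠ 0 ∧ a ^ (2 ^ m) ^ 2 = a ∧ b ≠ 0 ∧ b ^ (2 ^ m) ^ 2 = b ∧
          a ^ (2 ^ d * (2 ^ m - 1) / (2 ^ e - 1)) = b ^ ((2 ^ m - 1) / (2 ^ e - 1)))) := by
  have hinj := FaithfulSMul.algebraMap_injective K F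
  have hqq : (2 ^ m) ^ 2 = Fintype.card K := by rw [hK]; ring
  have hmem (x : F) : x ^ (2 ^ m) ^ 2 = x ↔ x ∈ Set.range (algebraMap K F) := by
    rw [mem_range_algebraMap_iff_pow_card_eq, hqq]
  have hmem1 (x : F) : x ∉ Set.range (algebraMap K F) → LinearIndependent K ![1, x] := fun hx ↦
    (LinearIndependent.pair_iff' one_ne_zero).mpr fun c hc ↦
      hx ⟨c, by rw [← hc, Algebra.smul_def, mul_one]⟩
  obtain ⟨w, hw⟩ : ∃ w : K, w ^ 2 ^ m ≠ w := by
    have := forall_mul_pow_eq_mul_imp_iff (d := d) hm hK he 0 0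
    simpa [zero_pow] using this
  have htr (c : K) (x : F) : Algebra.trace K F (algebraMap K F c * x) =
      c * Algebra.trace K F x := by rw [← Algebra.smul_def, map_smul, smul_eq_mul]
  by_cases ha : a ^ (2 ^ m) ^ 2 = a
  · by_cases hb : b ^ (2 ^ m) ^ 2 = b
    · obtain ⟨a, rfl⟩ := (hmem a).mp ha
      obtain ⟨b, rfl⟩ := (hmem b).mp hb
      have key := forall_mul_pow_eq_mul_imp_iff hm hK he a b
      have hl : (∀ x : F, Algebra.trace K F (algebraMap K F a * x) ^ 2 ^ d =
            Algebra.trace K F (algebraMap K F b * x) →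
          Algebra.trace K F x ^ 2 ^ m = Algebra.trace K F x) ↔
          ∀ w : K, (a * w) ^ 2 ^ d = b * w → w ^ 2 ^ m = w := by
        simp only [htr]
        exact ((Algebra.trace_surjective K F).forall
          (p := fun w ↦ (a * w) ^ 2 ^ d = b * w → w ^ 2 ^ m = w)).symm
      rw [hl, key]
      simp only [ha, hb, ← map_pow, hinj.eq_iff, ne_eq, true_and, not_true_eq_false, false_and,
        and_false, false_or, map_eq_zero_iff _ hinj]
    · simp only [ha, hb, ne_eq, not_true_eq_false, false_and, and_false, or_false, iff_false]
      intro h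
      obtain ⟨a, rfl⟩ := (hmem a).mp ha
      obtain ⟨x, hx⟩ := exists_trace_mul_eq_of_linearIndependent
        (hmem1 b (mt (hmem b).mpr hb)) ![w, (a * w) ^ 2 ^ d]
      have h0 := hx 0
      have h1 := hx 1
      simp only [Matrix.cons_val_zero, Matrix.cons_val_one, one_mul] at h0 h1
      have := h x
      rw [htr, h0, h1] at this
      exact hw (this rfl)
  have haK : a ∉ Set.range (algebraMap K F) := mt (hmem a).mpr ha
  simp only [ha, ne_eq, not_false_eq_true, true_and, false_and, and_false, or_false]
  have ha0 : a ^ (2 ^ m) ^ 2 + a ≠ 0 := by rwa [ne_eq, CharTwo.add_eq_zero]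
  have hpow3 (x : F) : x ^ (2 ^ m) ^ 3 = (x ^ (2 ^ m) ^ 2) ^ 2 ^ m := by
    rw [← pow_mul x, ← pow_succ]
  have hadd (x y : F) : (x + y) ^ 2 ^ m = x ^ 2 ^ m + y ^ 2 ^ m := add_pow_char_pow x y 2 m
  have hadd2 (x y : F) : (x + y) ^ (2 ^ m) ^ 2 = x ^ (2 ^ m) ^ 2 + y ^ (2 ^ m) ^ 2 := by
    simp only [← pow_mul 2 m 2, add_pow_char_pow]
  have hpow2 (x : F) : x ^ (2 ^ m) ^ 2 = (x ^ 2 ^ m) ^ 2 ^ m := by rw [← pow_mul x, ← sq]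
  by_cases hb : ∃ t c : K, b = algebraMap K F t * a + algebraMap K F c
  · obtain ⟨t, c, rfl⟩ := hb
    have htK := (hmem (algebraMap K F t)).mpr ⟨t, rfl⟩
    have hcK := (hmem (algebraMap K F c)).mpr ⟨c, rfl⟩
    have hl : (∀ x : F, Algebra.trace K F (a * x) ^ 2 ^ d =
          Algebra.trace K F ((algebraMap K F t * a + algebraMap K F c) * x) →
        Algebra.trace K F x ^ 2 ^ m = Algebra.trace K F x) ↔
        ∀ u w : K, u ^ 2 ^ d = t * u + c * w → w ^ 2 ^ m = w := by
      simp only [add_mul, mul_assoc, map_add, htr]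
      refine ⟨fun h u w huw ↦ ?_, fun h x hx ↦ h _ _ hx⟩
      obtain ⟨x, hx⟩ := exists_trace_mul_eq_of_linearIndependent (hmem1 a haK) ![w, u]
      have h0 := hx 0
      have h1 := hx 1
      simp only [Matrix.cons_val_zero, Matrix.cons_val_one, one_mul] at h0 h1
      have := h x
      rw [h0, h1] at this
      exact this huw
    set A := a ^ (2 ^ m) ^ 2 + a with hA
    have hδA : δ = A * algebraMap K F c := by
      rw [hδ, hadd2, mul_pow, htK, hcK]
      linear_combination (algebraMap K F t * a * a ^ (2 ^ m) ^ 2) * CharTwo.two_eq_zero (R := F)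
    have hB : (algebraMap K F t * a + algebraMap K F c) ^ (2 ^ m) ^ 2 +
        (algebraMap K F t * a + algebraMap K F c) = algebraMap K F t * A := by
      rw [hadd2, mul_pow, htK, hcK]
      linear_combination algebraMap K F c * CharTwo.two_eq_zero (R := F)
    rw [hpow3 a, hpow3, ← hadd, ← hadd, ← hA, hB, hδA, hl]
    by_cases hc : c = 0
    · subst hc
      simp only [map_zero, mul_zero, not_true_eq_false, false_and, and_false, iff_false]
      intro h
      exact hw (h 0 w (by simp))
    have hl2 : (∀ u w : K, u ^ 2 ^ d = t * u + c * w → w ^ 2 ^ m = w) ↔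
        ∀ u : K, ((u ^ 2 ^ d + t * u) / c) ^ 2 ^ m = (u ^ 2 ^ d + t * u) / c := by
      refine forall_congr' fun u ↦ ⟨fun h ↦ h _ ?_, fun h w huw ↦ ?_⟩
      · rw [mul_div_cancel₀ _ hc]
        linear_combination -(t * u) * CharTwo.two_eq_zero (R := K)
      · have : w = (u ^ 2 ^ d + t * u) / c := by
          rw [eq_div_iff hc, huw]
          linear_combination -(t * u) * CharTwo.two_eq_zero (R := K)
        rw [this, h]
    rw [hl2, forall_div_pow_eq_div_iff hd hd2 hK hc t]
    refine and_congr_right fun _ ↦ ?_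
    have hc' : algebraMap K F c ≠ 0 := (map_ne_zero_iff _ hinj).mpr hc
    have hAm : A ^ 2 ^ m ≠ 0 := pow_ne_zero _ ha0
    have hcm : c ^ 2 ^ m ≠ 0 := pow_ne_zero _ hc
    have e1 : (A * algebraMap K F c) ^ 2 ^ m * A +
        A * algebraMap K F c * (algebraMap K F t * A) ^ 2 ^ m =
        (A ^ 2 ^ m * A) * algebraMap K F (c ^ 2 ^ m + c * t ^ 2 ^ m) := by
      simp only [map_add, map_mul, map_pow, mul_pow]; ring
    have e2 : (A * algebraMap K F c) ^ 2 ^ m * (algebraMap K F t * A) +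
        A * algebraMap K F c * A ^ 2 ^ m =
        (A ^ 2 ^ m * A) * algebraMap K F (c ^ 2 ^ m * t + c) := by
      simp only [map_add, map_mul, map_pow, mul_pow]; ring
    rw [e1, e2, mul_eq_zero_iff_left (mul_ne_zero hAm ha0),
      mul_eq_zero_iff_left (mul_ne_zero hAm ha0), map_eq_zero_iff _ hinj, map_eq_zero_iff _ hinj,
      CharTwo.add_eq_zero, CharTwo.add_eq_zero]
    constructor
    · rintro ⟨h1, h2⟩
      refine ⟨mul_ne_zero ha0 hc', ?_, h1⟩
      linear_combination -c ^ 2 ^ m * h2 + t ^ 2 ^ m * h1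
    · rintro ⟨-, h1, h2⟩
      refine ⟨h2, mul_left_cancel₀ hcm ?_⟩
      linear_combination t ^ 2 ^ m * h2 - h1
  · refine iff_of_false (fun h ↦ ?_) ?_
    · have hli : LinearIndependent K ![b, 1, a] := by
        refine linearIndependent_finCons.mpr ⟨hmem1 a haK, fun hmb ↦ hb ?_⟩
        rw [Matrix.range_cons_cons_empty, Submodule.mem_span_pair] at hmb
        obtain ⟨c, t, h⟩ := hmb
        exact ⟨t, c, by rw [← h, Algebra.smul_def, Algebra.smul_def, mul_one, add_comm]⟩
      obtain ⟨x, hx⟩ := exists_trace_mul_eq_of_linearIndependent hli ![0, w, 0]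
      have h0 := hx 0
      have h1 := hx 1
      have h2 := hx 2
      simp only [Matrix.cons_val, one_mul] at h0 h1 h2
      have := h x
      rw [h0, h1, h2] at this
      exact hw (this (zero_pow (by positivity)))
    · rintro ⟨-, hδ0, h1, h2⟩
      set A := a ^ (2 ^ m) ^ 2 + a with hA
      set B := b ^ (2 ^ m) ^ 2 + b with hB
      rw [hpow3, ← hadd, ← hB, CharTwo.add_eq_zero] at h1
      rw [hpow3, ← hadd, ← hA, CharTwo.add_eq_zero] at h2
      have hδ1 : δ ^ 2 ^ m ≠ 0 := pow_ne_zero _ hδ0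
      obtain ⟨t, ht⟩ : ∃ t, B = t * A := ⟨B / A, (div_mul_cancel₀ _ ha0).symm⟩
      have hAm : A ^ 2 ^ m ≠ 0 := pow_ne_zero _ ha0
      rw [ht, mul_pow] at h1
      rw [ht] at h2
      have ht1 : t ^ 2 ^ m * t = 1 := by
        refine mul_left_cancel₀ (mul_ne_zero hδ0 hAm) ?_
        linear_combination h2 - t * h1
      have htK : t ^ (2 ^ m) ^ 2 = t := by
        have h3 : (t ^ 2 ^ m * t) ^ 2 ^ m = 1 := by rw [ht1, one_pow]
        rw [mul_pow, ← hpow2] at h3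
        linear_combination t * h3 - t ^ (2 ^ m) ^ 2 * ht1
      have hcK : (b + t * a) ^ (2 ^ m) ^ 2 = b + t * a := by
        rw [hadd2, mul_pow, htK, ← CharTwo.add_eq_zero]
        linear_combination ht + t * A * CharTwo.two_eq_zero (R := F) - t * hA + hB
      obtain ⟨t, rfl⟩ := (hmem t).mp htK
      obtain ⟨c, hc⟩ := (hmem _).mp hcK
      refine hb ⟨t, c, ?_⟩
      rw [hc]
      linear_combination -(algebraMap K F t * a) * CharTwo.two_eq_zero (R := F)

theorem sum_range_two_mul_pow_pow {R : Type*} [CommSemiring R] [CharP R 2] (x : R) (m h : ℕ) :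
    ∑ i ∈ Finset.range (2 * h), x ^ (2 ^ m) ^ i =
      ∑ i ∈ Finset.range h, x ^ ((2 ^ m) ^ 2) ^ i +
        (∑ i ∈ Finset.range h, x ^ ((2 ^ m) ^ 2) ^ i) ^ 2 ^ m := by
  rw [sum_pow_char_pow, ← Finset.sum_add_distrib]
  induction h with
  | zero => simp
  | succ h ih =>
    rw [mul_add_one, Finset.sum_range_succ, Finset.sum_range_succ, ih, Finset.sum_range_succ,
      add_assoc, pow_succ (2 ^ m) (2 * h), pow_mul (2 ^ m) 2 h, pow_mul x]

end Trace

/-- Let `n` be even, `q = 2^m`, `F` the field with `q^n` elements, and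
`L(x) = L_k(x^(2^k)) + L_l(x^(2^l))` with `L_k, L_l` `q^2`-linear polynomials
(`L_k(x) = Σ_{j<n/2} ck j · x^((q^2)^j)`, similarly `L_l`) and `0 ≤ k < l < 2m`.  Set
`e = gcd(l-k, 2m)`, `a = L_k(1)`, `b = L_l(1)`, `δ = a^(q^2)·b + a·b^(q^2)`, and let `L'` be
the adjoint of `L`.  Then `ker(Tr_2 ∘ L') ⊆ ker Tr` iff one of the three listed conditions
holds. -/
theorem stmt_17 (m n : ℕ) (hm : 0 < m) (hn : Even n) (hn0 : 0 < n)
    (F : Type*) [Field F] [Fintype F] (hF : Fintype.card F = 2 ^ (m * n))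
    (ck cl : Fin (n / 2) → F) (k l : ℕ) (hk : k < l) (hl : l < 2 * m)
    (e : ℕ) (he : e = Nat.gcd (l - k) (2 * m))
    (a b δ : F) (ha : a = ∑ j : Fin (n / 2), ck j) (hb : b = ∑ j : Fin (n / 2), cl j)
    (hδ : δ = a ^ (2 ^ m) ^ 2 * b + a * b ^ (2 ^ m) ^ 2)
    (L' Tr Tr2 : F → F)
    (hL' : ∀ x, L' x =
        (∑ j : Fin (n / 2), (ck j * x) ^ 2 ^ (m * n - (k + 2 * m * (j : ℕ)))) +
        ∑ j : Fin (n / 2), (cl j * x) ^ 2 ^ (m * n - (l + 2 * m * (j : ℕ))))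
    (hTr : ∀ x, Tr x = ∑ i ∈ Finset.range n, x ^ (2 ^ m) ^ i)
    (hTr2 : ∀ x, Tr2 x = ∑ i ∈ Finset.range (n / 2), x ^ ((2 ^ m) ^ 2) ^ i) :
    ({x : F | Tr2 (L' x) = 0} ⊆ {x : F | Tr x = 0}) ↔
      ((l - k = m ∧ a ^ (2 ^ m) ^ 2 ≠ a ∧ δ ≠ 0 ∧
          δ ^ 2 ^ m * (a ^ (2 ^ m) ^ 2 + a) + δ * (b ^ (2 ^ m) ^ 3 + b ^ 2 ^ m) = 0 ∧
          δ ^ 2 ^ m * (b ^ (2 ^ m) ^ 2 + b) + δ * (a ^ (2 ^ m) ^ 3 + a ^ 2 ^ m) = 0) ∨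
       (a ^ (2 ^ m) ^ 2 = a ∧ b ^ (2 ^ m) ^ 2 = b ∧
          a ^ ((2 ^ (2 * m) - 1) / (2 ^ e - 1)) ≠ b ^ ((2 ^ (2 * m) - 1) / (2 ^ e - 1))) ∨
       (e ∣ m ∧ a ≠ 0 ∧ a ^ (2 ^ m) ^ 2 = a ∧ b ≠ 0 ∧ b ^ (2 ^ m) ^ 2 = b ∧
          a ^ (2 ^ (l - k) * (2 ^ m - 1) / (2 ^ e - 1)) =
            b ^ ((2 ^ m - 1) / (2 ^ e - 1)))) := by
    classical
  generalize hnh : n / 2 = h at *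
  obtain rfl : n = 2 * h := by have := hn.two_dvd; omega
  have hh : 0 < h := by omega
  have hm2 : 2 * m ≠ 0 := by omega
  have : Fact (Nat.Prime 2) := ⟨Nat.prime_two⟩
  have : CharP F 2 := charP_of_card_eq_prime_pow hF
  let : Algebra (ZMod 2) F := ZMod.algebra F 2
  have hfr : Module.finrank (ZMod 2) F = m * (2 * h) := by
    have := FiniteField.pow_finrank_eq_card 2 F
    exact Nat.pow_right_injective le_rfl (this.trans hF)
  let K := GaloisField 2 (2 * m)
  let : Fintype K := Fintype.ofFinite K
  have hK : Fintype.card K = 2 ^ (2 * m) := by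
    rw [← Nat.card_eq_fintype_card]; exact GaloisField.card 2 _ hm2
  obtain ⟨f⟩ : Nonempty (K →ₐ[ZMod 2] F) :=
    FiniteField.nonempty_algHom_of_finrank_dvd
      (by rw [hfr, GaloisField.finrank 2 hm2]; exact ⟨h, by ring⟩)
  let : Algebra K F := f.toRingHom.toAlgebra
  have hfrK : Module.finrank K F = h := by
    have h1 : Fintype.card F = Fintype.card K ^ Module.finrank K F := Module.card_eq_pow_finrank
    rw [hF, hK, ← pow_mul] at h1
    have h2 := Nat.pow_right_injective le_rfl h1
    exact (Nat.eq_of_mul_eq_mul_left (Nat.pos_of_ne_zero hm2) (by rw [← h2]; ring)).symm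
  have hinj := FaithfulSMul.algebraMap_injective K F
  have hKu (u : K) : u ^ 2 ^ (2 * m) = u := hK ▸ FiniteField.pow_card u
  have hT2 (x : F) : Tr2 x = algebraMap K F (Algebra.trace K F x) := by
    rw [hTr2, FiniteField.algebraMap_trace_eq_sum_pow, hfrK, Nat.card_eq_fintype_card, hK,
      mul_comm 2 m, pow_mul]
  have hT (x : F) : Tr x = 0 ↔ Algebra.trace K F x ^ 2 ^ m = Algebra.trace K F x := by
    rw [hTr, sum_range_two_mul_pow_pow, ← hTr2, hT2, ← map_pow, ← map_add,
      map_eq_zero_iff _ hinj, CharTwo.add_eq_zero, eq_comm]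
  have hKi (u : K) (i : ℕ) : u ^ 2 ^ (2 * m * i) = u := by
    induction i with
    | zero => simp
    | succ i ih => rw [mul_add_one, pow_add, pow_mul, ih, hKu]
  have hbound (j : Fin h) : ∃ r, h = j + 1 + r := ⟨h - (j + 1), by omega⟩
  have hterm (y : F) (j : Fin h) {p : ℕ} (hp : p ≤ l) :
      Algebra.trace K F (y ^ 2 ^ (m * (2 * h) - (p + 2 * m * (j : ℕ)))) ^ 2 ^ l =
        Algebra.trace K F y ^ 2 ^ (l - p) := by
    obtain ⟨r, hr⟩ := hbound j
    have hexp : m * (2 * h) - (p + 2 * m * (j : ℕ)) + l = 2 * m * (r + 1) + (l - p) := by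
      have h1 : m * (2 * h) = 2 * m * j + 2 * m * (r + 1) := by
        calc m * (2 * h) = m * (2 * (j + 1 + r)) := by rw [← hr]
          _ = _ := by ring
      have h2 : 2 * m * (r + 1) = 2 * m * r + 2 * m := by ring
      omega
    rw [trace_pow_two_pow_s17, ← pow_mul, ← pow_add, hexp, pow_add, pow_mul, hKi]
  have hker (x : F) : Tr2 (L' x) = 0 ↔
      Algebra.trace K F (a * x) ^ 2 ^ (l - k) = Algebra.trace K F (b * x) := by
    rw [hT2, map_eq_zero_iff _ hinj, ← pow_eq_zero_iff (n := 2 ^ l) (by positivity), hL', map_add,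
      map_sum, map_sum, add_pow_char_pow, sum_pow_char_pow, sum_pow_char_pow,
      CharTwo.add_eq_zero]
    simp only [hterm _ _ hk.le, hterm _ _ le_rfl, Nat.sub_self, pow_zero, pow_one]
    rw [← sum_pow_char_pow, ← map_sum, ← map_sum, ha, hb, Finset.sum_mul, Finset.sum_mul]
  simp only [Set.ofPred_subset_ofPred, hker, hT]
  exact forall_trace_pow_eq_imp_iff hm (by omega) (by omega) hK he a b δ hδ
end

section
/- Let n be even, L(x) = a·x^{2^k} + b·x^{2^l} be nonzero with a, b ∈ F_{q^n}, and k, l integers with 0 ≤ k < l < mn. Set d = gcd(l-k, mn), e = gcd(l-k, 2m), and δ = a^{q^2}·b + a·b^{q^2}. Then Tr(x^{q+1}) + L(x) is a permutation polynomial of F_{q^n} if and only if a^{(q^n-1)/(2^d-1)} ≠ b^{(q^n-1)/(2^d-1)} and one of the following holds: (1) l - k ≡ m (mod 2m), a ∉ F_{q^2}, δ ≠ 0, and δ^q·(a^{q^2}+a) + δ·(b^{q^3}+b^q) = 0 and δ^q·(b^{q^2}+b) + δ·(a^{q^3}+a^q) = 0; (2) k ≢ l (mod 2m), a, b ∈ F_{q^2},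 and a^{(q^2-1)/(2^e-1)} ≠ b^{(q^2-1)/(2^e-1)}; (3) k ≡ l (mod 2m) and a + b ∈ F_{q^2}. -/
/-- In a finite cyclic group `G`, an element killed by `|G| / gcd (|G|, t)` is a `t`-th power. -/
theorem exists_pow_eq_of_pow_card_div_gcd {G : Type*} [CommGroup G] [IsCyclic G] [Finite G]
    {t : ℕ} {u : G} (hu : u ^ (Nat.card G / (Nat.card G).gcd t) = 1) : ∃ y, y ^ t = u := by
  set E := Nat.card G / (Nat.card G).gcd t with hE
  have hdvd : E ∣ Nat.card G := Nat.div_dvd_of_dvd (Nat.gcd_dvd_left _ _)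
  have hle : (powMonoidHom t : G →* G).range ≤ (powMonoidHom E : G →* G).ker := by
    rintro _ ⟨y, rfl⟩
    rw [MonoidHom.mem_ker, powMonoidHom_apply, powMonoidHom_apply, ← pow_mul]
    have : t * E = Nat.card G * (t / (Nat.card G).gcd t) := by
      rw [hE, ← Nat.mul_div_assoc _ (Nat.gcd_dvd_left _ _),
        ← Nat.mul_div_assoc _ (Nat.gcd_dvd_right _ _), mul_comm]
    rw [this, pow_mul, pow_card_eq_one', one_pow]
  have heq : (powMonoidHom t : G →* G).range = (powMonoidHom E : G →* G).ker := by
    refine Subgroup.eq_of_le_of_card_ge hle ?_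
    rw [IsCyclic.card_powMonoidHom_range, IsCyclic.card_powMonoidHom_ker, Nat.gcd_eq_right hdvd]
  have : u ∈ (powMonoidHom t : G →* G).range := by
    rw [heq]
    exact hu
  exact this

theorem pow_two_pow_mul_eq_self {M : Type*} [Monoid M] {z : M} {r : ℕ} (hz : z ^ 2 ^ r = z)
    (t : ℕ) : z ^ 2 ^ (r * t) = z := by
  induction t with
  | zero => simp
  | succ t ih => rw [Nat.mul_succ, pow_add, pow_mul, ih, hz]

theorem pow_two_pow_mod {M : Type*} [Monoid M] {z : M} {r : ℕ} (hz : z ^ 2 ^ r = z) (s : ℕ) :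
    z ^ 2 ^ s = z ^ 2 ^ (s % r) := by
  conv_lhs => rw [← Nat.div_add_mod s r, pow_add, pow_mul, pow_two_pow_mul_eq_self hz]

theorem mod_eq_of_le_gcd {m s : ℕ} (hm : 0 < m) (h : m ≤ s.gcd (2 * m))
    (hs : s % (2 * m) ≠ 0) : s % (2 * m) = m := by
  obtain ⟨c, hc⟩ := Nat.gcd_dvd_right s (2 * m)
  have hes : s.gcd (2 * m) ∣ s := Nat.gcd_dvd_left _ _
  generalize s.gcd (2 * m) = e at h hc hes
  have hc1 : c ≠ 1 := by
    rintro rfl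
    rw [mul_one] at hc
    exact hs (Nat.mod_eq_zero_of_dvd (hc ▸ hes))
  have hc0 : c ≠ 0 := by
    rintro rfl
    omega
  have hc2 : e * 2 ≤ e * c := Nat.mul_le_mul_left e (by omega)
  obtain rfl : e = m := by omega
  obtain ⟨t, rfl⟩ := hes
  rw [mul_comm 2 e, Nat.mul_mod_mul_left] at hs ⊢
  rcases Nat.mod_two_eq_zero_or_one t with ht | ht
  · exact absurd (by rw [ht, mul_zero]) hs
  · rw [ht, mul_one]

section FiniteField

variable {F : Type*} [Field F]

theorem pow_two_pow_injective [CharP F 2] (k : ℕ) : Function.Injective fun x : F => x ^ 2 ^ k :=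
  iterateFrobenius_inj F 2 k

theorem pow_two_pow_surjective [Finite F] [CharP F 2] (k : ℕ) : Function.Surjective fun x : F => x ^ 2 ^ k :=
  Finite.surjective_of_injective (pow_two_pow_injective k)

theorem pow_eq_self_iff {x : F} (hx : x ≠ 0) {r : ℕ} : x ^ 2 ^ r = x ↔ x ^ (2 ^ r - 1) = 1 := by
  have h : x ^ 2 ^ r = x ^ (2 ^ r - 1) * x := by
    rw [← pow_succ, Nat.sub_add_cancel Nat.one_le_two_pow]
  rw [h]
  exact mul_eq_right₀ hx

theorem two_pow_sub_one_div_pos {d N : ℕ} (hN : 0 < N) (h : d ∣ N) :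
    0 < (2 ^ N - 1) / (2 ^ d - 1) := by
  have hd : 0 < d := Nat.pos_of_dvd_of_pos h hN
  have hle : 2 ^ d ≤ 2 ^ N := Nat.pow_le_pow_right (by norm_num) (Nat.le_of_dvd hN h)
  have := Nat.one_lt_two_pow hd.ne'
  exact Nat.div_pos (by omega) (by omega)

/-- The kernel of the binomial `a x^(2^k) + b x^(2^l)` is trivial exactly when `a / b` is not
a `(2^(l-k) - 1)`-th power. -/
theorem binomial_ker_trivial_iff [Fintype F] [CharP F 2] {N : ℕ} (hN : 0 < N) (hF : Fintype.card F = 2 ^ N)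
    {a b : F} {k l : ℕ} (hk : k < l) (hab : ¬(a = 0 ∧ b = 0)) :
    (∀ x : F, a * x ^ 2 ^ k + b * x ^ 2 ^ l = 0 → x = 0) ↔
      a ^ ((2 ^ N - 1) / (2 ^ (l - k).gcd N - 1)) ≠ b ^ ((2 ^ N - 1) / (2 ^ (l - k).gcd N - 1)) := by
  classical
  set s := l - k with hs
  have hl : 2 ^ l = 2 ^ k * 2 ^ s := by rw [← pow_add]; congr 1; omega
  set E := (2 ^ N - 1) / (2 ^ s.gcd N - 1) with hE
  have hEpos : 0 < E := two_pow_sub_one_div_pos hN (Nat.gcd_dvd_right _ _)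
  have hsplit : ∀ y : F, y ^ 2 ^ s = y ^ (2 ^ s - 1) * y := fun y => by
    rw [← pow_succ, Nat.sub_add_cancel Nat.one_le_two_pow]
  have hEd : 2 ^ N - 1 ∣ (2 ^ s - 1) * E := by
    obtain ⟨c, hc⟩ := Nat.pow_sub_one_dvd_pow_sub_one 2 (Nat.gcd_dvd_left s N)
    have h := Nat.mul_div_cancel' (Nat.pow_sub_one_dvd_pow_sub_one 2 (Nat.gcd_dvd_right s N))
    rw [hc, mul_right_comm, hE, h]
    exact dvd_mul_right _ _
  have hcard : Nat.card Fˣ = 2 ^ N - 1 := by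
    rw [Nat.card_eq_fintype_card, Fintype.card_units, hF]
  constructor
  · intro h heq
    have hb : b ≠ 0 := by
      rintro rfl
      rw [zero_pow hEpos.ne', pow_eq_zero_iff hEpos.ne'] at heq
      exact hab ⟨heq, rfl⟩
    have ha : a ≠ 0 := by
      rintro rfl
      rw [zero_pow hEpos.ne', eq_comm, pow_eq_zero_iff hEpos.ne'] at heq
      exact hab ⟨rfl, heq⟩
    obtain ⟨y, hy⟩ := exists_pow_eq_of_pow_card_div_gcd (G := Fˣ) (t := 2 ^ s - 1)
      (u := Units.mk0 a ha / Units.mk0 b hb) (by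
        rw [hcard, Nat.pow_sub_one_gcd_pow_sub_one, Nat.gcd_comm N s, ← hE, div_pow, div_eq_one]
        ext
        simpa using heq)
    have hy' : b * (y : F) ^ (2 ^ s - 1) = a := by
      have := congrArg Units.val hy
      rw [Units.val_pow_eq_pow_val] at this
      rw [this]
      simp only [Units.val_div_eq_div_val, Units.val_mk0]
      field_simp
    obtain ⟨x, hx⟩ := pow_two_pow_surjective (F := F) k (y : F)
    have hx : x ^ 2 ^ k = y := hx
    have h0 : x = 0 := h x (by
      rw [hl, pow_mul, hx, hsplit, ← mul_assoc, hy']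
      exact CharTwo.add_self_eq_zero _)
    rw [h0, zero_pow (by positivity)] at hx
    exact y.ne_zero hx.symm
  · intro hne x hx
    by_contra hx0
    apply hne
    have hy0 : x ^ 2 ^ k ≠ 0 := pow_ne_zero _ hx0
    rw [hl, pow_mul, hsplit, ← mul_assoc, ← add_mul] at hx
    have ha := CharTwo.add_eq_zero.mp ((mul_eq_zero.mp hx).resolve_right hy0)
    obtain ⟨c, hc⟩ := hEd
    have h1 : (x ^ 2 ^ k) ^ (2 ^ N - 1) = 1 := by
      rw [← hF]
      exact FiniteField.pow_card_sub_one_eq_one _ hy0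
    rw [ha, mul_pow, ← pow_mul, hc, pow_mul, h1, one_pow, mul_one]

/-- The number of units fixed by the `r`-th power of Frobenius. -/
theorem card_pow_two_pow_sub_one_ker [Fintype F] {N r : ℕ} (hF : Fintype.card F = 2 ^ N) :
    Nat.card (powMonoidHom (2 ^ r - 1) : Fˣ →* Fˣ).ker = 2 ^ N.gcd r - 1 := by
  classical
  rw [IsCyclic.card_powMonoidHom_ker, Nat.card_eq_fintype_card, Fintype.card_units, hF,
    Nat.pow_sub_one_gcd_pow_sub_one]

/-- The relative trace polynomial does not vanish identically. -/
theorem exists_sum_pow_ne_zero [Fintype F] {q n : ℕ} (hq : 1 < q) (hn : 0 < n)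
    (hF : Fintype.card F = q ^ n) : ∃ x : F, ∑ i ∈ Finset.range n, x ^ q ^ i ≠ 0 := by
  by_contra! h
  set P : Polynomial F := ∑ i ∈ Finset.range n, Polynomial.X ^ q ^ i with hP
  have hdeg : P.natDegree ≤ q ^ (n - 1) := by
    refine Polynomial.natDegree_sum_le_of_forall_le _ _ fun i hi => ?_
    rw [Polynomial.natDegree_X_pow]
    exact Nat.pow_le_pow_right (by omega) (by have := Finset.mem_range.mp hi; omega)
  have hP0 : P = 0 := by
    refine Polynomial.eq_zero_of_natDegree_lt_card_of_eval_eq_zero P (f := (id : F → F))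
      Function.injective_id (fun x => ?_) (hdeg.trans_lt ?_)
    · simpa [hP, Polynomial.eval_finsetSum] using h x
    · rw [hF]
      exact Nat.pow_lt_pow_right hq (by omega)
  have hc : P.coeff 1 = 1 := by
    rw [hP, Polynomial.finsetSum_coeff, Finset.sum_eq_single 0]
    · simp
    · intro i _ hi
      rw [Polynomial.coeff_X_pow, if_neg]
      exact (Nat.one_lt_pow hi hq).ne
    · intro h0
      exact absurd (Finset.mem_range.mpr hn) h0
  rw [hP0] at hc
  simp at hc

/-- `Tr(x^(q+1)) + L(x)` permutes `F` iff `L` is injective and only elements of the subfield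
of order `q^2` are mapped into the subfield of order `q` by `L`. -/
theorem bijective_trace_add_iff [Fintype F] [CharP F 2] {m n : ℕ} (hm : 0 < m) (hn : Even n) (hn0 : 0 < n)
    (hF : Fintype.card F = (2 ^ m) ^ n) (Tr : F → F)
    (hTr : ∀ x, Tr x = ∑ i ∈ Finset.range n, x ^ (2 ^ m) ^ i) (L : F → F)
    (hL : ∀ x y, L (x + y) = L x + L y) :
    Function.Bijective (fun x : F => Tr (x ^ (2 ^ m + 1)) + L x) ↔
      (∀ z, L z = 0 → z = 0) ∧ ∀ z, L z ^ 2 ^ m = L z → z ^ (2 ^ m) ^ 2 = z := by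
  have hfrob : ∀ (i : ℕ) (x y : F), (x + y) ^ (2 ^ m) ^ i = x ^ (2 ^ m) ^ i + y ^ (2 ^ m) ^ i := by
    intro i x y
    rw [← pow_mul]
    exact add_pow_char_pow x y 2 _
  have hfrob1 : ∀ x y : F, (x + y) ^ 2 ^ m = x ^ 2 ^ m + y ^ 2 ^ m := fun x y =>
    add_pow_char_pow x y 2 _
  have hadd : ∀ x y, Tr (x + y) = Tr x + Tr y := fun x y => by
    simp only [hTr, hfrob, Finset.sum_add_distrib]
  have hsmul : ∀ t x, t ^ 2 ^ m = t → Tr (t * x) = t * Tr x := fun t x ht => by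
    rw [hTr, hTr, Finset.mul_sum]
    refine Finset.sum_congr rfl fun i _ => ?_
    rw [mul_pow, ← pow_mul 2, pow_two_pow_mul_eq_self ht]
  have hTrpow : ∀ x, Tr x ^ 2 ^ m = Tr (x ^ 2 ^ m) := fun x => by
    rw [hTr, hTr, sum_pow_char_pow]
    exact Finset.sum_congr rfl fun i _ => pow_right_comm _ _ _
  have hcard : ∀ x : F, x ^ (2 ^ m) ^ n = x := fun x => by
    rw [← hF]
    exact FiniteField.pow_card x
  have hTrfrob : ∀ x, Tr (x ^ 2 ^ m) = Tr x := fun x => by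
    have h := Finset.sum_range_succ (fun i => x ^ (2 ^ m) ^ i) n
    rw [Finset.sum_range_succ', hcard] at h
    rw [hTr, hTr]
    simpa [pow_succ', pow_mul] using h
  have hTrfix : ∀ x, Tr x ^ 2 ^ m = Tr x := fun x => by rw [hTrpow, hTrfrob]
  have hTr0 : ∀ x, x ^ 2 ^ m = x → Tr x = 0 := fun x hx => by
    have : Tr x = ∑ i ∈ Finset.range n, x := by
      rw [hTr]
      exact Finset.sum_congr rfl fun i _ => by rw [← pow_mul 2, pow_two_pow_mul_eq_self hx]
    rw [this, Finset.sum_const, Finset.card_range, nsmul_eq_mul,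
      (CharP.cast_eq_zero_iff F 2 n).mpr hn.two_dvd, zero_mul]
  have hTr00 : Tr 0 = 0 := hTr0 0 (zero_pow (by positivity))
  have hL0 : L 0 = 0 := by simpa using hL 0 0
  have hQ0 : ∀ z : F, z ^ (2 ^ m) ^ 2 = z → Tr (z ^ (2 ^ m + 1)) = 0 := fun z hz => by
    apply hTr0
    rw [← pow_mul, add_mul, one_mul, ← sq, pow_add, hz, pow_succ, mul_comm]
  set c : F → F := fun z => z ^ (2 ^ m) ^ (n - 1) + z ^ 2 ^ m with hc
  have hroot : ∀ z : F, (z ^ (2 ^ m) ^ (n - 1)) ^ 2 ^ m = z := fun z => by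
    rw [← pow_mul, ← pow_succ, Nat.sub_add_cancel hn0, hcard]
  have hc0 : ∀ z, c z = 0 ↔ z ^ (2 ^ m) ^ 2 = z := fun z => by
    rw [hc, CharTwo.add_eq_zero, ← (pow_two_pow_injective (F := F) m).eq_iff]
    rw [hroot, ← pow_mul, ← sq, eq_comm]
  have hpolar : ∀ x z, Tr ((x + z) ^ (2 ^ m + 1)) =
      Tr (x ^ (2 ^ m + 1)) + (Tr (x * c z) + Tr (z ^ (2 ^ m + 1))) := fun x z => by
    have h1 : Tr (x * z ^ (2 ^ m) ^ (n - 1)) = Tr (x ^ 2 ^ m * z) := by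
      rw [← hTrfrob, mul_pow, hroot]
    rw [hc, mul_add, hadd, h1, ← hadd, ← hadd, ← hadd, pow_succ, hfrob1]
    congr 1
    ring
  have hsurj : ∀ w t : F, w ≠ 0 → t ^ 2 ^ m = t → ∃ x, Tr (x * w) = t := fun w t hw ht => by
    obtain ⟨x, hx⟩ := exists_sum_pow_ne_zero (Nat.one_lt_two_pow hm.ne') hn0 hF
    rw [← hTr] at hx
    refine ⟨t / Tr x * x / w, ?_⟩
    rw [div_mul_cancel₀ _ hw, hsmul _ _ (by rw [div_pow, ht, hTrfix]), div_mul_cancel₀ _ hx]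
  rw [← Finite.injective_iff_bijective]
  constructor
  · intro hinj
    have key : ∀ z, L z ^ 2 ^ m = L z → z ^ (2 ^ m) ^ 2 = z := by
      intro z hz
      by_contra hne
      obtain ⟨x, hx⟩ := hsurj (c z) (Tr (z ^ (2 ^ m + 1)) + L z)
        (fun h => hne ((hc0 z).mp h)) (by rw [hfrob1, hTrfix, hz])
      have : x + z = x := hinj (by
        dsimp only
        rw [hpolar, hL, hx]
        linear_combination CharTwo.add_self_eq_zero (Tr (z ^ (2 ^ m + 1)) + L z))
      rw [add_eq_left] at this
      apply hne
      rw [this, zero_pow (by positivity)]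
    refine ⟨fun z hz => ?_, key⟩
    have hz2 := key z (by rw [hz, zero_pow (by positivity)])
    apply hinj
    dsimp only
    rw [hQ0 z hz2, hz, hL0, zero_pow (by positivity), hTr00]
  · rintro ⟨h0, h2⟩ x y hxy
    dsimp only at hxy
    obtain ⟨z, rfl⟩ : ∃ z, y = x + z := ⟨y - x, by ring⟩
    rw [hpolar, hL] at hxy
    have hLz : L z = Tr (x * c z) + Tr (z ^ (2 ^ m + 1)) := by
      rw [← CharTwo.add_eq_zero]
      linear_combination -hxy
    have hz2 := h2 z (by rw [hLz, hfrob1, hTrfix, hTrfix])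
    rw [(hc0 z).mpr hz2, mul_zero, hTr00, hQ0 z hz2, add_zero] at hLz
    rw [h0 z hLz, add_zero]

/-- If `L(x) = a x^(2^k) + b x^(2^l)` is injective, the preimage of the subfield of order `2^m`
lies in the subfield of order `2 ^ (2 * m)`, the coefficients are not both in the latter and
`k ≢ l (mod 2 * m)`, then `l - k ≡ m (mod 2 * m)`. -/
theorem sub_mod_eq_of_preimage_fixed [Fintype F] [CharP F 2] {m N : ℕ} (hm : 0 < m)
    (hF : Fintype.card F = 2 ^ N) (hmN : 2 * m ∣ N) {a b : F} {k l : ℕ} (hk : k < l)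
    (hker : ∀ x : F, a * x ^ 2 ^ k + b * x ^ 2 ^ l = 0 → x = 0)
    (hpre : ∀ x : F, (a * x ^ 2 ^ k + b * x ^ 2 ^ l) ^ 2 ^ m = a * x ^ 2 ^ k + b * x ^ 2 ^ l →
      x ^ 2 ^ (2 * m) = x)
    (hab : ¬(a ^ 2 ^ (2 * m) = a ∧ b ^ 2 ^ (2 * m) = b)) (hkl : (l - k) % (2 * m) ≠ 0) :
    (l - k) % (2 * m) = m := by
  set s := l - k with hs
  have hl : 2 ^ l = 2 ^ k * 2 ^ s := by rw [← pow_add]; congr 1; omega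
  set L : F → F := fun x => a * x ^ 2 ^ k + b * x ^ 2 ^ l with hL
  have hLadd : ∀ x y, L (x + y) = L x + L y := fun x y => by
    simp only [hL, add_pow_char_pow]
    ring
  have hinj : Function.Injective L := fun x y hxy => by
    rw [← CharTwo.add_eq_zero]
    apply hker
    change L (x + y) = 0
    rw [hLadd, hxy, CharTwo.add_self_eq_zero]
  have hsurj : Function.Surjective L := Finite.surjective_of_injective hinj
  choose g hg using hsurj
  have hg0 : ∀ c, c ≠ 0 → g c ≠ 0 := fun c hc h => hc (by
    rw [← hg c, h]
    simp [hL])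
  have hfix : ∀ c, c ^ 2 ^ m = c → g c ^ 2 ^ (2 * m) = g c := fun c hc =>
    hpre _ (by
      change L (g c) ^ 2 ^ m = L (g c)
      rw [hg, hc])
  set A := a ^ 2 ^ (2 * m) + a with hA
  set B := b ^ 2 ^ (2 * m) + b with hB
  have hrel : ∀ c, c ^ 2 ^ m = c → A * g c ^ 2 ^ k = B * g c ^ 2 ^ l := fun c hc => by
    have h1 : L (g c) ^ 2 ^ (2 * m) = L (g c) := by
      rw [hg, mul_comm 2 m, pow_two_pow_mul_eq_self hc]
    have h2 := hfix c hc
    simp only [hL, add_pow_char_pow, mul_pow, pow_right_comm _ _ (2 ^ (2 * m)), h2] at h1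
    rw [← CharTwo.add_eq_zero, hA, hB]
    linear_combination h1 + a * (CharTwo.add_self_eq_zero (g c ^ 2 ^ k)) +
      b * (CharTwo.add_self_eq_zero (g c ^ 2 ^ l))
  have hAB : A ≠ 0 ∧ B ≠ 0 := by
    have h1 := hrel 1 (one_pow _)
    have h2 := hg0 1 one_ne_zero
    have h3 : ¬(A = 0 ∧ B = 0) := by
      rwa [hA, hB, CharTwo.add_eq_zero, CharTwo.add_eq_zero]
    constructor
    · intro h
      rw [h, zero_mul, eq_comm, mul_eq_zero] at h1
      exact h3 ⟨h, h1.resolve_right (pow_ne_zero _ h2)⟩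
    · intro h
      rw [h, zero_mul, mul_eq_zero] at h1
      exact h3 ⟨h1.resolve_right (pow_ne_zero _ h2), h⟩
  set e := s.gcd (2 * m) with he
  have hratio : ∀ u : Fˣ, u ^ (2 ^ m - 1) = 1 →
      (Units.mk0 (g u) (hg0 u u.ne_zero) / Units.mk0 (g 1) (hg0 1 one_ne_zero)) ^ (2 ^ e - 1)
        = 1 := by
    intro u hu
    have hu' : (u : F) ^ 2 ^ m = u := by
      rw [pow_eq_self_iff u.ne_zero, ← Units.val_pow_eq_pow_val, hu, Units.val_one]
    have hz0 := hg0 1 one_ne_zero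
    have hr0 : g u / g 1 ≠ 0 := div_ne_zero (hg0 u u.ne_zero) hz0
    have h1 : (g u / g 1) ^ 2 ^ (2 * m) = g u / g 1 := by
      rw [div_pow, hfix _ hu', hfix _ (one_pow _)]
    have h2 : (g u / g 1) ^ 2 ^ s = g u / g 1 := by
      apply pow_two_pow_injective (F := F) k
      dsimp only
      have e1 := hrel _ hu'
      have e2 := hrel 1 (one_pow _)
      rw [← pow_mul, mul_comm, ← hl, div_pow, div_pow,
        div_eq_div_iff (pow_ne_zero _ hz0) (pow_ne_zero _ hz0)]
      apply mul_left_cancel₀ (mul_ne_zero hAB.1 hAB.2)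
      linear_combination (-A * g 1 ^ 2 ^ k) * e1 + (A * g u ^ 2 ^ k) * e2
    rw [pow_eq_self_iff hr0] at h1 h2
    ext
    rw [he, ← Nat.pow_sub_one_gcd_pow_sub_one]
    simpa using pow_gcd_eq_one.mpr ⟨h2, h1⟩
  have hcard : Nat.card (powMonoidHom (2 ^ m - 1) : Fˣ →* Fˣ).ker ≤
      Nat.card (powMonoidHom (2 ^ e - 1) : Fˣ →* Fˣ).ker := by
    refine Nat.card_le_card_of_injective (fun u => ⟨_, hratio u.1 u.2⟩) ?_
    intro u v huv
    have h := congrArg (fun w : (powMonoidHom (2 ^ e - 1) : Fˣ →* Fˣ).ker => (w : Fˣ)) huv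
    dsimp only at h
    rw [div_left_inj] at h
    have h' : g (u : Fˣ) = g (v : Fˣ) := congrArg Units.val h
    have h'' := congrArg L h'
    rw [hg, hg] at h''
    exact Subtype.ext (Units.ext h'')
  have he2m : e ∣ 2 * m := Nat.gcd_dvd_right _ _
  rw [card_pow_two_pow_sub_one_ker hF, card_pow_two_pow_sub_one_ker hF,
    Nat.gcd_eq_right ((Dvd.intro_left 2 rfl).trans hmN), Nat.gcd_eq_right (he2m.trans hmN)] at hcard
  have hme : m ≤ e := by
    rw [← Nat.pow_le_pow_iff_right (a := 2) (by norm_num)]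
    have := Nat.one_le_two_pow (n := m)
    have := Nat.one_le_two_pow (n := e)
    omega
  exact mod_eq_of_le_gcd hm hme hkl

end FiniteField

theorem two_pow_sub_one_div_dvd {d r N : ℕ} (hN : 0 < N) (hd : d ∣ N) (hr : r ∣ N) :
    (2 ^ r - 1) / (2 ^ d.gcd r - 1) ∣ (2 ^ N - 1) / (2 ^ d - 1) := by
  have hd1 := Nat.one_lt_two_pow (Nat.pos_of_dvd_of_pos hd hN).ne'
  have h := Nat.lcm_dvd (Nat.pow_sub_one_dvd_pow_sub_one 2 hd)
    (Nat.pow_sub_one_dvd_pow_sub_one 2 hr)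
  rw [Nat.lcm, Nat.pow_sub_one_gcd_pow_sub_one, Nat.mul_div_assoc _
    (Nat.pow_sub_one_dvd_pow_sub_one 2 (Nat.gcd_dvd_right d r))] at h
  rw [Nat.dvd_div_iff_mul_dvd (Nat.pow_sub_one_dvd_pow_sub_one 2 hd)]
  exact h


/-- Let `n` be even, `q = 2^m`, `F` the field with `q^n` elements, and
`L(x) = a·x^(2^k) + b·x^(2^l)` nonzero with `0 ≤ k < l < mn`.  Set `d = gcd(l-k, mn)`,
`e = gcd(l-k, 2m)`, `δ = a^(q^2)·b + a·b^(q^2)`.  Then `Tr(x^(q+1)) + L(x)` is a permutation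
polynomial of `F` iff `a^((q^n-1)/(2^d-1)) ≠ b^((q^n-1)/(2^d-1))` and one of the three listed
conditions holds. -/
theorem stmt_18 (m n : ℕ) (hm : 0 < m) (hn : Even n) (hn0 : 0 < n)
    (F : Type*) [Field F] [Fintype F] (hF : Fintype.card F = 2 ^ (m * n))
    (a b : F) (k l : ℕ) (hk : k < l) (hl : l < m * n)
    (hab : ¬(a = 0 ∧ b = 0))
    (d e : ℕ) (hd : d = Nat.gcd (l - k) (m * n)) (he : e = Nat.gcd (l - k) (2 * m))
    (δ : F) (hδ : δ = a ^ (2 ^ m) ^ 2 * b + a * b ^ (2 ^ m) ^ 2)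
    (Tr : F → F)
    (hTr : ∀ x, Tr x = ∑ i ∈ Finset.range n, x ^ (2 ^ m) ^ i) :
    Function.Bijective (fun x : F => Tr (x ^ (2 ^ m + 1)) + (a * x ^ 2 ^ k + b * x ^ 2 ^ l)) ↔
      (a ^ ((2 ^ (m * n) - 1) / (2 ^ d - 1)) ≠ b ^ ((2 ^ (m * n) - 1) / (2 ^ d - 1)) ∧
        (((l - k) % (2 * m) = m ∧ a ^ (2 ^ m) ^ 2 ≠ a ∧ δ ≠ 0 ∧
            δ ^ 2 ^ m * (a ^ (2 ^ m) ^ 2 + a) + δ * (b ^ (2 ^ m) ^ 3 + b ^ 2 ^ m) = 0 ∧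
            δ ^ 2 ^ m * (b ^ (2 ^ m) ^ 2 + b) + δ * (a ^ (2 ^ m) ^ 3 + a ^ 2 ^ m) = 0) ∨
         (k % (2 * m) ≠ l % (2 * m) ∧ a ^ (2 ^ m) ^ 2 = a ∧ b ^ (2 ^ m) ^ 2 = b ∧
            a ^ ((2 ^ (2 * m) - 1) / (2 ^ e - 1)) ≠ b ^ ((2 ^ (2 * m) - 1) / (2 ^ e - 1))) ∨
         (k % (2 * m) = l % (2 * m) ∧ (a + b) ^ (2 ^ m) ^ 2 = a + b))) := by
  have : CharP F 2 := charP_of_card_eq_prime_pow hF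
  have hN : 0 < m * n := Nat.mul_pos hm hn0
  have hmN : 2 * m ∣ m * n := by
    rw [mul_comm 2 m]
    exact Nat.mul_dvd_mul_left m hn.two_dvd
  rw [bijective_trace_add_iff hm hn hn0 (by rw [hF, pow_mul]) Tr hTr
    (fun x => a * x ^ 2 ^ k + b * x ^ 2 ^ l) (fun x y => by
      simp only [add_pow_char_pow]
      ring), binomial_ker_trivial_iff hN hF hk hab, ← hd]
  refine and_congr_right fun hne => ?_
  have hker := (binomial_ker_trivial_iff hN hF hk hab).mpr (hd ▸ hne)
  have hq2 : (2 ^ m) ^ 2 = 2 ^ (2 * m) := by rw [← pow_mul, mul_comm]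
  have hq3 : (2 ^ m) ^ 3 = 2 ^ (2 * m) * 2 ^ m := by rw [← hq2, pow_succ]
  simp only [hq2, hq3] at hδ ⊢
  have hl' : 2 ^ l = 2 ^ k * 2 ^ (l - k) := by rw [← pow_add]; congr 1; omega
  have hmod : k % (2 * m) = l % (2 * m) ↔ (l - k) % (2 * m) = 0 := by
    rw [← Nat.dvd_iff_mod_eq_zero]
    exact Nat.modEq_iff_dvd' hk.le
  have hadd : ∀ (i : ℕ) (x y : F), (x + y) ^ 2 ^ i = x ^ 2 ^ i + y ^ 2 ^ i := fun i x y =>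
    add_pow_char_pow x y 2 i
  have hroot : ∀ w : F, w ^ 2 ^ (2 * m) = w → ∃ z, z ^ 2 ^ (2 * m) = z ∧ z ^ 2 ^ k = w := by
    intro w hw
    obtain ⟨z, hz⟩ := pow_two_pow_surjective (F := F) k w
    dsimp only at hz
    refine ⟨z, pow_two_pow_injective k ?_, hz⟩
    dsimp only
    rw [pow_right_comm, hz, hw]
  have huniq : ∀ x z : F, z ^ 2 ^ (2 * m) = z →
      a * z ^ 2 ^ k + b * z ^ 2 ^ l = a * x ^ 2 ^ k + b * x ^ 2 ^ l → x ^ 2 ^ (2 * m) = x := by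
    intro x z hz h
    have : x + z = 0 := hker _ (by
      rw [hadd, hadd]
      linear_combination -h + a * CharTwo.add_self_eq_zero (z ^ 2 ^ k) +
        b * CharTwo.add_self_eq_zero (z ^ 2 ^ l))
    rwa [CharTwo.add_eq_zero.mp this]
  constructor
  · intro hpre
    have hsurj : Function.Surjective fun x : F => a * x ^ 2 ^ k + b * x ^ 2 ^ l := by
      refine Finite.surjective_of_injective fun x y hxy => ?_
      rw [← CharTwo.add_eq_zero]
      apply hker
      rw [hadd, hadd]
      linear_combination -hxy + a * CharTwo.add_self_eq_zero (x ^ 2 ^ k) +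
        b * CharTwo.add_self_eq_zero (x ^ 2 ^ l)
    obtain ⟨z, hz⟩ := hsurj 1
    dsimp only at hz
    have hz2 := hpre z (by rw [hz, one_pow])
    have hz0 : z ≠ 0 := by
      rintro rfl
      simp at hz
    set w := z ^ 2 ^ k with hw
    have hw0 : w ≠ 0 := pow_ne_zero _ hz0
    have hw2 : w ^ 2 ^ (2 * m) = w := by rw [hw, pow_right_comm, hz2]
    rw [hl', pow_mul, ← hw, pow_two_pow_mod hw2] at hz
    by_cases h0 : (l - k) % (2 * m) = 0
    · refine Or.inr (Or.inr ⟨hmod.mpr h0, ?_⟩)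
      rw [h0, pow_zero, pow_one, ← add_mul] at hz
      rw [eq_inv_of_mul_eq_one_left hz, inv_pow, hw2]
    by_cases hab2 : a ^ 2 ^ (2 * m) = a ∧ b ^ 2 ^ (2 * m) = b
    · refine Or.inr (Or.inl ⟨fun h => h0 (hmod.mp h), hab2.1, hab2.2, fun h => hne ?_⟩)
      have hdvd := two_pow_sub_one_div_dvd hN (hd ▸ Nat.gcd_dvd_right _ _ : d ∣ m * n) hmN
      rw [hd, Nat.gcd_assoc, Nat.gcd_eq_right hmN, ← he, ← hd] at hdvd
      obtain ⟨c, hc⟩ := hdvd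
      rw [hc, pow_mul, h, ← pow_mul]
    · have hmm := sub_mod_eq_of_preimage_fixed hm hF hmN hk hker hpre hab2 h0
      left
      rw [hmm] at hz
      have hz' : a ^ 2 ^ (2 * m) * w + b ^ 2 ^ (2 * m) * w ^ 2 ^ m = 1 := by
        have := congrArg (· ^ 2 ^ (2 * m)) hz
        simpa only [hadd, mul_pow, pow_right_comm w (2 ^ m), hw2, one_pow] using this
      have hB : δ * w = b ^ 2 ^ (2 * m) + b := by
        linear_combination w * hδ + b * hz' + b ^ 2 ^ (2 * m) * hz -
          b * b ^ 2 ^ (2 * m) * CharTwo.add_self_eq_zero (w ^ 2 ^ m)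
      have hA : δ * w ^ 2 ^ m = a ^ 2 ^ (2 * m) + a := by
        linear_combination w ^ 2 ^ m * hδ + a * hz' + a ^ 2 ^ (2 * m) * hz -
          a * a ^ 2 ^ (2 * m) * CharTwo.add_self_eq_zero w
      have hww : (w ^ 2 ^ m) ^ 2 ^ m = w := by
        rw [← pow_mul, ← pow_add, ← two_mul, hw2]
      have hBq := congrArg (· ^ 2 ^ m) hB
      have hAq := congrArg (· ^ 2 ^ m) hA
      simp only [hadd, mul_pow, hww, ← pow_mul] at hBq hAq
      have hδ0 : δ ≠ 0 := by
        intro h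
        rw [h, zero_mul, eq_comm, CharTwo.add_eq_zero] at hA hB
        exact hab2 ⟨hA, hB⟩
      refine ⟨hmm, fun h => ?_, hδ0, ?_, ?_⟩
      · rw [h, CharTwo.add_self_eq_zero] at hA
        exact mul_ne_zero hδ0 (pow_ne_zero _ hw0) hA
      · rw [← hA, ← hBq, mul_left_comm]
        exact CharTwo.add_self_eq_zero _
      · rw [← hB, ← hAq, mul_left_comm]
        exact CharTwo.add_self_eq_zero _
  · rintro (⟨hmm, ha, hδ0, h1, h2⟩ | ⟨hkl, ha, hb, -⟩ | ⟨hkl, hab2⟩) x hx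
    · set c := a * x ^ 2 ^ k + b * x ^ 2 ^ l with hc
      have hδq : δ ^ 2 ^ m ≠ 0 := pow_ne_zero _ hδ0
      have hw1 : ((b ^ 2 ^ (2 * m) + b) / δ) ^ 2 ^ m = (a ^ 2 ^ (2 * m) + a) / δ := by
        rw [div_pow, hadd, ← pow_mul, div_eq_div_iff hδq hδ0, ← CharTwo.add_eq_zero]
        linear_combination h1
      have hw2 : ((a ^ 2 ^ (2 * m) + a) / δ) ^ 2 ^ m = (b ^ 2 ^ (2 * m) + b) / δ := by
        rw [div_pow, hadd, ← pow_mul, div_eq_div_iff hδq hδ0, ← CharTwo.add_eq_zero]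
        linear_combination h2
      set w := (b ^ 2 ^ (2 * m) + b) / δ with hw
      have hww : w ^ 2 ^ (2 * m) = w := by rw [two_mul, pow_add, pow_mul, hw1, hw2]
      obtain ⟨z, hz2, hz⟩ := hroot (c * w) (by
        rw [mul_pow, hww, mul_comm 2 m, pow_two_pow_mul_eq_self hx])
      refine huniq x z hz2 ?_
      have hcw : (c * w) ^ 2 ^ (2 * m) = c * w := by rw [← hz, pow_right_comm, hz2]
      have hzl : z ^ 2 ^ l = c * ((a ^ 2 ^ (2 * m) + a) / δ) := by
        rw [hl', pow_mul, hz, pow_two_pow_mod hcw, hmm, mul_pow, hx, hw1]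
      rw [hzl, hz, ← hc, hw]
      field_simp
      linear_combination -c * hδ + c * CharTwo.add_self_eq_zero (a * b)
    · rw [← CharTwo.add_eq_zero]
      apply hker
      have hx2 := pow_two_pow_mul_eq_self hx 2
      rw [mul_comm m 2, hadd, mul_pow, mul_pow, ha, hb, pow_right_comm x (2 ^ k), pow_right_comm x (2 ^ l)] at hx2
      rw [hadd, hadd, mul_add, mul_add, add_add_add_comm, hx2]
      exact CharTwo.add_self_eq_zero _
    · rw [hmod] at hkl
      have hab0 : a + b ≠ 0 := fun h => one_ne_zero (hker 1 (by simpa using h))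
      obtain ⟨z, hz2, hz⟩ := hroot ((a * x ^ 2 ^ k + b * x ^ 2 ^ l) / (a + b)) (by
        rw [div_pow, hab2, mul_comm 2 m, pow_two_pow_mul_eq_self hx])
      refine huniq x z hz2 ?_
      have : z ^ 2 ^ (l - k) = z := by
        rw [pow_two_pow_mod hz2, hkl, pow_zero, pow_one]
      rw [hl', mul_comm (2 ^ k) (2 ^ (l - k)), pow_mul, this, ← add_mul, hz,
        mul_div_cancel₀ _ hab0, mul_comm (2 ^ (l - k)), ← hl']
end
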